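/- arXiv:1707.08109 — 3 statements merged into one kernel-verified Lean document; each statement's English description precedes it below -/
import Mathlib

section
/- Let α and β be Martin-Löf random left-c.e. reals and let (α_s) → α and (β_s) → β be any left-c.e. approximations. Then lim_s (α − α_s)/(β − β_s) exists, is a positive real number, and its value does not depend on the choice of the left-c.e. approximations (α_s) and (β_s). -/
open scoped Classical

/-- A set of binary strings is prefix-free if no element is a proper prefix of another. -/
def PrefixFreeSet (D : Set (List Bool)) : Prop :=
  ∀ σ ∈ D, ∀ τ ∈ D, σ <+: τ → σ = τ

/-- A prefix-free machine: a partial computable function on binary strings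
whose domain is prefix-free. -/
structure PFMachine where
  f : List Bool →. List Bool
  partrec : Partrec f
  prefixFree : PrefixFreeSet {σ | (f σ).Dom}

/-- The halting probability `Ω_M = Σ_{σ ∈ dom M} 2^{-|σ|}` of a prefix-free machine. -/
noncomputable def omegaOf (M : PFMachine) : ℝ :=
  ∑' σ : {σ : List Bool // (M.f σ).Dom}, (2 : ℝ) ^ (-(σ.1.length : ℤ))

/-- A computable nondecreasing sequence of rationals converging to `x`. -/
def LeftCEApprox (q : ℕ → ℚ) (x : ℝ) : Prop :=
  Computable q ∧ Monotone q ∧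
    Filter.Tendsto (fun n => (q n : ℝ)) Filter.atTop (nhds x)

/-- A real is left-c.e. if some computable nondecreasing rational sequence converges to it. -/
def LeftCE (x : ℝ) : Prop := ∃ q : ℕ → ℚ, LeftCEApprox q x

/-- A real is right-c.e. if its negative is left-c.e. -/
def RightCE (x : ℝ) : Prop := LeftCE (-x)

/-- Martin-Löf randomness of a real, via computable sequences of open rational intervals. -/
def MLRandom (x : ℝ) : Prop :=
  ∀ I : ℕ → ℕ → ℚ × ℚ, Computable₂ I →
    (∀ n : ℕ, MeasureTheory.volume
        (⋃ k : ℕ, Set.Ioo (((I n k).1 : ℝ)) (((I n k).2 : ℝ))) ≤ 2 ^ (-(n : ℤ))) →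
    x ∉ ⋂ n : ℕ, ⋃ k : ℕ, Set.Ioo (((I n k).1 : ℝ)) (((I n k).2 : ℝ))

/-- A universal prefix-free machine: it simulates every prefix-free machine
via a fixed prefix. -/
def UniversalPF (U : PFMachine) : Prop :=
  ∀ M : PFMachine, ∃ ρ : List Bool, ∀ σ : List Bool, U.f (ρ ++ σ) = M.f σ

/-- The `i`-th binary digit of a real (of its expansion not ending in all 1s). -/
noncomputable def rdigit (x : ℝ) (i : ℕ) : Bool := decide (⌊x * 2 ^ (i + 1)⌋ % 2 = 1)

/-- The first `n` binary digits of a real. -/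
noncomputable def bits (x : ℝ) (n : ℕ) : List Bool := (List.range n).map (rdigit x)

/-- Prefix-free Kolmogorov complexity of `σ` with respect to machine `M`,
with value `⊤` if `σ` is not in the range. -/
noncomputable def Kf (M : PFMachine) (σ : List Bool) : ℕ∞ :=
  ⨅ p : {p : List Bool // σ ∈ M.f p}, (p.1.length : ℕ∞)

/-- An optimal prefix-free machine: minimizes `K` up to additive constants. -/
def OptimalPF (V : PFMachine) : Prop :=
  ∀ M : PFMachine, ∃ c : ℕ, ∀ σ : List Bool, Kf V σ ≤ Kf M σ + c

/-- Solovay reducibility for left-c.e. reals. -/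
def SolovayRed (α β : ℝ) : Prop :=
  ∃ c : ℚ, ∃ f : ℚ →. ℚ, Partrec f ∧
    ∀ q : ℚ, (q : ℝ) < β →
      ∃ r ∈ f q, (r : ℝ) < α ∧ α - (r : ℝ) < (c : ℝ) * (β - (q : ℝ))

/-- `X` is computable from `Y` with oracle-use `h`. -/
def ComputableFromWithUse (X Y : ℝ) (h : ℕ → ℕ) : Prop :=
  ∃ Φ : List Bool →. List Bool, Partrec Φ ∧
    ∀ n : ℕ, Φ (bits Y (h n)) = Part.some (bits X n)

namespace RatCoding

open Encodable Denumerable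

/-- The code of a rational from which `Rat.instDenumerable` is built, by ranking. -/
def pairCode (q : ℚ) : ℕ := @encode ℚ Rat.instEncodable q

theorem pairCode_eq (q : ℚ) : pairCode q = Nat.pair (Equiv.intEquivNat q.num) q.den := rfl

theorem pairCode_injective : Function.Injective pairCode :=
  @encode_injective ℚ Rat.instEncodable

instance : Infinite (Set.range pairCode) :=
  Infinite.of_injective _ (Equiv.ofInjective _ pairCode_injective).injective

theorem pairCode_ofNat (n : ℕ) :
    pairCode (ofNat ℚ n) = (Nat.Subtype.ofNat (Set.range pairCode) n : ℕ) := by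
  have h : pairCode (ofNat ℚ n) = (@Nat.Subtype.ofNat (Set.range pairCode)
      (@Encodable.decidableRangeEncode ℚ Rat.instEncodable) inferInstance n : ℕ) :=
    congrArg Subtype.val ((@Encodable.equivRangeEncode ℚ Rat.instEncodable).apply_symm_apply _)
  rw [h]
  congr
  exact Subsingleton.elim _ _

theorem intEquivNat_ofNat (n : ℕ) : Equiv.intEquivNat (n : ℤ) = 2 * n := rfl

theorem intEquivNat_negSucc (n : ℕ) : Equiv.intEquivNat (Int.negSucc n) = 2 * n + 1 := rfl

theorem natAbs_eq_intEquivNat (z : ℤ) : z.natAbs = (Equiv.intEquivNat z + 1) / 2 := by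
  cases z with
  | ofNat n => rw [Int.ofNat_eq_natCast, intEquivNat_ofNat, Int.natAbs_natCast]; omega
  | negSucc n => rw [intEquivNat_negSucc, Int.natAbs_negSucc]; omega

theorem mem_range_pairCode (k : ℕ) :
    k ∈ Set.range pairCode ↔ k.unpair.2 ≠ 0 ∧
      ¬ ∃ x < k.unpair.2 + 1, 2 ≤ x ∧ (k.unpair.1 + 1) / 2 % x = 0 ∧ k.unpair.2 % x = 0 := by
  have key : ∀ a d : ℕ, d ≠ 0 →
      (a.Coprime d ↔ ¬ ∃ x < d + 1, 2 ≤ x ∧ a % x = 0 ∧ d % x = 0) := by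
    intro a d hd
    constructor
    · rintro h ⟨x, -, h2, ha, hx⟩
      have := Nat.dvd_gcd (Nat.dvd_of_mod_eq_zero ha) (Nat.dvd_of_mod_eq_zero hx)
      rw [h.gcd_eq_one] at this
      have := Nat.le_of_dvd one_pos this
      omega
    · intro h
      by_contra hc
      have hg : a.gcd d ≠ 0 := fun h0 => hd (Nat.eq_zero_of_gcd_eq_zero_right h0)
      have hc' : a.gcd d ≠ 1 := hc
      refine h ⟨a.gcd d, Nat.lt_succ_of_le (Nat.le_of_dvd (Nat.pos_of_ne_zero hd)
        (Nat.gcd_dvd_right a d)), by omega, Nat.mod_eq_zero_of_dvd (Nat.gcd_dvd_left a d),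
        Nat.mod_eq_zero_of_dvd (Nat.gcd_dvd_right a d)⟩
  constructor
  · rintro ⟨q, rfl⟩
    rw [pairCode_eq, Nat.unpair_pair]
    dsimp only
    rw [← natAbs_eq_intEquivNat]
    exact ⟨q.den_nz, (key _ _ q.den_nz).1 q.reduced⟩
  · rintro ⟨hd, h⟩
    rw [← key _ _ hd] at h
    have hz : (k.unpair.1 + 1) / 2 = (Equiv.intEquivNat.symm k.unpair.1).natAbs := by
      rw [natAbs_eq_intEquivNat, Equiv.apply_symm_apply]
    rw [hz] at h
    refine ⟨⟨Equiv.intEquivNat.symm k.unpair.1, k.unpair.2, hd, h⟩, ?_⟩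
    rw [pairCode_eq, Equiv.apply_symm_apply, Nat.pair_unpair]

theorem primrecPred_mem_range_pairCode : PrimrecPred (· ∈ Set.range pairCode) := by
  have h1 : Primrec fun k : ℕ => k.unpair.1 := Primrec.fst.comp Primrec.unpair
  have h2 : Primrec fun k : ℕ => k.unpair.2 := Primrec.snd.comp Primrec.unpair
  have hR : PrimrecRel fun x k : ℕ =>
      2 ≤ x ∧ (k.unpair.1 + 1) / 2 % x = 0 ∧ k.unpair.2 % x = 0 := by
    refine PrimrecPred.and (Primrec.nat_le.comp (.const 2) .fst) (PrimrecPred.and ?_ ?_)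
    · exact Primrec.eq.comp (Primrec.nat_mod.comp (Primrec.nat_div.comp
        (Primrec.succ.comp (h1.comp .snd)) (.const 2)) .fst) (.const 0)
    · exact Primrec.eq.comp (Primrec.nat_mod.comp (h2.comp .snd) .fst) (.const 0)
  refine PrimrecPred.of_eq (PrimrecPred.and (Primrec.eq.comp h2 (.const 0)).not
    (hR.exists_lt.comp (Primrec.succ.comp h2) .id).not) fun k => (mem_range_pairCode k).symm

theorem computable_pairCode_ofNat : Computable fun n => pairCode (ofNat ℚ n) := by
  have hex : ∀ x : ℕ, ∃ m, x + m + 1 ∈ Set.range pairCode := fun x => by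
    obtain ⟨y, hy, hxy⟩ :=
      (Set.infinite_coe_iff.1 (inferInstance : Infinite (Set.range pairCode))).exists_gt x
    exact ⟨y - x - 1, by rwa [show x + (y - x - 1) + 1 = y by omega]⟩
  have hfind : Computable fun x => Nat.find (hex x) := by
    refine Computable.find (P := fun x m => x + m + 1 ∈ Set.range pairCode) ?_ hex
    exact (primrecPred_mem_range_pairCode.comp (Primrec.succ.comp
      (Primrec.nat_add.comp .fst .snd))).computablePred
  have hstep : Computable fun x => x + Nat.find (hex x) + 1 :=
    Computable.succ.comp (Primrec.nat_add.to_comp.comp .id hfind)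
  refine (Computable.nat_rec (f := fun n : ℕ => n) (g := fun _ => pairCode (ofNat ℚ 0))
    (h := fun _ p => p.2 + Nat.find (hex p.2) + 1) .id (.const _)
    (hstep.comp (Computable.snd.comp .snd)).to₂).of_eq fun n => ?_
  induction n with
  | zero => rfl
  | succ n ih =>
    dsimp only at ih ⊢
    rw [ih, pairCode_ofNat (n + 1)]
    simp only [Nat.Subtype.ofNat, Nat.Subtype.succ]
    have hcongr : ∀ x y : ℕ, x = y → ∀ hy : ∃ m, y + m + 1 ∈ Set.range pairCode,
        x + Nat.find (hex x) + 1 = y + Nat.find hy + 1 := by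
      rintro x _ rfl hy
      rfl
    exact hcongr _ _ (pairCode_ofNat n) _

theorem computable_pairCode : Computable pairCode :=
  (computable_pairCode_ofNat.comp Computable.encode).of_eq fun q => by rw [ofNat_encode]

/-- Computable access to a rational through natural numbers. -/
theorem exists_natParts : ∃ P M D : ℚ → ℕ, Computable P ∧ Computable M ∧ Computable D ∧
    ∀ q, 0 < D q ∧ q = ((P q : ℚ) - M q) / D q := by
  have hz : Computable fun q => (pairCode q).unpair.1 :=
    Computable.fst.comp (Computable.unpair.comp computable_pairCode)
  have hd : Computable fun q => (pairCode q).unpair.2 :=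
    Computable.snd.comp (Computable.unpair.comp computable_pairCode)
  have hP : Primrec fun z : ℕ => (z + 1) / 2 * (1 - z % 2) :=
    Primrec.nat_mul.comp (Primrec.nat_div.comp Primrec.succ (.const 2))
      (Primrec.nat_sub.comp (.const 1) (Primrec.nat_mod.comp .id (.const 2)))
  have hM : Primrec fun z : ℕ => (z + 1) / 2 * (z % 2) :=
    Primrec.nat_mul.comp (Primrec.nat_div.comp Primrec.succ (.const 2))
      (Primrec.nat_mod.comp .id (.const 2))
  refine ⟨_, _, _, hP.to_comp.comp hz, hM.to_comp.comp hz, hd, fun q => ?_⟩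
  simp only [pairCode_eq, Nat.unpair_pair]
  refine ⟨q.den_pos, ?_⟩
  have : (q.num : ℚ) = (((Equiv.intEquivNat q.num + 1) / 2 * (1 - Equiv.intEquivNat q.num % 2) : ℕ)
      : ℚ) - (((Equiv.intEquivNat q.num + 1) / 2 * (Equiv.intEquivNat q.num % 2) : ℕ) : ℚ) := by
    cases q.num with
    | ofNat n =>
      rw [Int.ofNat_eq_natCast, intEquivNat_ofNat, Nat.mul_mod_right,
        show (2 * n + 1) / 2 = n by omega]
      simp
    | negSucc n =>
      rw [intEquivNat_negSucc, show (2 * n + 1) % 2 = 1 by omega,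
        show (2 * n + 1 + 1) / 2 = n + 1 by omega]
      simp [Int.negSucc_eq]
  rw [← this, Rat.num_div_den]

variable {X : Type*} [Primcodable X]

/-- The numerator of the positive part. -/
noncomputable def posPart : ℚ → ℕ := exists_natParts.choose

/-- The numerator of the negative part. -/
noncomputable def negPart : ℚ → ℕ := exists_natParts.choose_spec.choose

/-- A denominator. -/
noncomputable def den : ℚ → ℕ := exists_natParts.choose_spec.choose_spec.choose

theorem natParts_spec : Computable posPart ∧ Computable negPart ∧ Computable den ∧
    ∀ q, 0 < den q ∧ q = ((posPart q : ℚ) - negPart q) / den q :=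
  exists_natParts.choose_spec.choose_spec.choose_spec

theorem den_ne_zero (q : ℚ) : (den q : ℚ) ≠ 0 :=
  Nat.cast_ne_zero.2 (natParts_spec.2.2.2 q).1.ne'

theorem eq_natParts (q : ℚ) : q = ((posPart q : ℚ) - negPart q) / den q :=
  (natParts_spec.2.2.2 q).2

theorem _root_.Computable.nat_add' {f g : X → ℕ} (hf : Computable f) (hg : Computable g) :
    Computable fun x => f x + g x := Primrec.nat_add.to_comp.comp hf hg

theorem _root_.Computable.nat_mul' {f g : X → ℕ} (hf : Computable f) (hg : Computable g) :
    Computable fun x => f x * g x := Primrec.nat_mul.to_comp.comp hf hg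

/-- A rational-valued function is computable as soon as its numerator (a difference of
naturals) and denominator are. -/
theorem _root_.Computable.rat_of_natParts {p m d : X → ℕ} (hp : Computable p) (hm : Computable m)
    (hd : Computable d) {F : X → ℚ} (hF : ∀ x, d x ≠ 0 ∧ F x = ((p x : ℚ) - m x) / d x) :
    Computable F := by
  obtain ⟨hP, hM, hD, -⟩ := natParts_spec
  have hiff : ∀ x (q : ℚ),
      (posPart q * d x + m x * den q = p x * den q + negPart q * d x) ↔ q = F x := by
    intro x q
    rw [(hF x).2]
    conv_rhs => rw [eq_natParts q]
    rw [div_eq_div_iff (den_ne_zero q) (Nat.cast_ne_zero.2 (hF x).1), ← @Nat.cast_inj ℚ]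
    push_cast
    constructor <;> intro h <;> linarith
  have hex : ∀ x, ∃ n : ℕ, posPart (ofNat ℚ n) * d x + m x * den (ofNat ℚ n) =
      p x * den (ofNat ℚ n) + negPart (ofNat ℚ n) * d x := fun x =>
    ⟨@encode ℚ (Primcodable.toEncodable) (F x), (hiff _ _).2 (@ofNat_encode ℚ _ (F x))⟩
  have hq : Computable fun y : X × ℕ => ofNat ℚ y.2 := (Computable.ofNat ℚ).comp .snd
  have hfind : Computable fun x => Nat.find (hex x) := by
    refine Computable.find ?_ hex
    refine Computable.computablePred ?_
    exact Primrec.eq.decide.to_comp.comp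
      (((hP.comp hq).nat_mul' (hd.comp .fst)).nat_add' ((hm.comp .fst).nat_mul' (hD.comp hq)))
      (((hp.comp .fst).nat_mul' (hD.comp hq)).nat_add' ((hM.comp hq).nat_mul' (hd.comp .fst)))
  exact ((Computable.ofNat ℚ).comp hfind).of_eq fun x => (hiff x _).1 (Nat.find_spec (hex x))

theorem _root_.Computable.rat_add {f g : X → ℚ} (hf : Computable f) (hg : Computable g) :
    Computable fun x => f x + g x := by
  obtain ⟨hP, hM, hD, -⟩ := natParts_spec
  refine Computable.rat_of_natParts
    (((hP.comp hf).nat_mul' (hD.comp hg)).nat_add' ((hP.comp hg).nat_mul' (hD.comp hf)))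
    (((hM.comp hf).nat_mul' (hD.comp hg)).nat_add' ((hM.comp hg).nat_mul' (hD.comp hf)))
    ((hD.comp hf).nat_mul' (hD.comp hg)) fun x => ?_
  have h1 := den_ne_zero (f x)
  have h2 := den_ne_zero (g x)
  refine ⟨mul_ne_zero (Nat.cast_ne_zero.1 h1) (Nat.cast_ne_zero.1 h2), ?_⟩
  conv_lhs => rw [eq_natParts (f x), eq_natParts (g x)]
  push_cast
  field_simp
  ring

theorem _root_.Computable.rat_mul {f g : X → ℚ} (hf : Computable f) (hg : Computable g) :
    Computable fun x => f x * g x := by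
  obtain ⟨hP, hM, hD, -⟩ := natParts_spec
  refine Computable.rat_of_natParts
    (((hP.comp hf).nat_mul' (hP.comp hg)).nat_add' ((hM.comp hf).nat_mul' (hM.comp hg)))
    (((hP.comp hf).nat_mul' (hM.comp hg)).nat_add' ((hM.comp hf).nat_mul' (hP.comp hg)))
    ((hD.comp hf).nat_mul' (hD.comp hg)) fun x => ?_
  have h1 := den_ne_zero (f x)
  have h2 := den_ne_zero (g x)
  refine ⟨mul_ne_zero (Nat.cast_ne_zero.1 h1) (Nat.cast_ne_zero.1 h2), ?_⟩
  conv_lhs => rw [eq_natParts (f x), eq_natParts (g x)]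
  push_cast
  field_simp
  ring

theorem _root_.Computable.rat_sub {f g : X → ℚ} (hf : Computable f) (hg : Computable g) :
    Computable fun x => f x - g x :=
  (hf.rat_add ((Computable.const (-1)).rat_mul hg)).of_eq fun x => by ring

theorem _root_.ComputablePred.rat_lt {f g : X → ℚ} (hf : Computable f) (hg : Computable g) :
    ComputablePred fun x => f x < g x := by
  obtain ⟨hP, hM, hD, -⟩ := natParts_spec
  have h : ComputablePred fun x => posPart (f x) * den (g x) + negPart (g x) * den (f x) <
      posPart (g x) * den (f x) + negPart (f x) * den (g x) :=
    Computable.computablePred (Primrec.nat_lt.decide.to_comp.comp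
      (((hP.comp hf).nat_mul' (hD.comp hg)).nat_add' ((hM.comp hg).nat_mul' (hD.comp hf)))
      (((hP.comp hg).nat_mul' (hD.comp hf)).nat_add' ((hM.comp hf).nat_mul' (hD.comp hg))))
  refine h.of_eq fun x => ?_
  conv_rhs => rw [eq_natParts (f x), eq_natParts (g x)]
  have h1 : (0 : ℚ) < den (f x) := Nat.cast_pos.2 (natParts_spec.2.2.2 _).1
  have h2 : (0 : ℚ) < den (g x) := Nat.cast_pos.2 (natParts_spec.2.2.2 _).1
  rw [div_lt_div_iff₀ h1 h2, ← @Nat.cast_lt ℚ]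
  push_cast
  constructor <;> intro h <;> linarith

theorem _root_.Computable.ite_pred {Y : Type*} [Primcodable Y] {c : X → Prop} [DecidablePred c]
    {f g : X → Y} (hc : ComputablePred c) (hf : Computable f) (hg : Computable g) :
    Computable fun x => if c x then f x else g x := by
  simpa [Bool.cond_decide] using hc.decide.cond hf hg

theorem computable_half_pow : Computable fun n : ℕ => ((1 : ℚ) / 2) ^ n := by
  refine (Computable.nat_rec (f := fun n : ℕ => n) (g := fun _ => (1 : ℚ))
    (h := fun _ p => p.2 * (1 / 2)) .id (.const _)
    ((Computable.snd.comp .snd).rat_mul (.const _)).to₂).of_eq fun n => ?_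
  induction n with
  | zero => simp
  | succ n ih => dsimp only at ih ⊢; rw [ih, pow_succ]

end RatCoding

/-- The first stage in `[s, t]` at which `g` attains its maximum over `[s, t]`. -/
noncomputable def argmaxFrom (g : ℕ → ℚ) (s t : ℕ) : ℕ :=
  Nat.rec s (fun k m => if g m < g (s + k + 1) then s + k + 1 else m) (t - s)

theorem argmaxFrom_self (g : ℕ → ℚ) (s : ℕ) : argmaxFrom g s s = s := by
  simp [argmaxFrom]

theorem argmaxFrom_succ (g : ℕ → ℚ) {s t : ℕ} (h : s ≤ t) :
    argmaxFrom g s (t + 1) =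
      if g (argmaxFrom g s t) < g (t + 1) then t + 1 else argmaxFrom g s t := by
  obtain ⟨k, rfl⟩ := Nat.exists_eq_add_of_le h
  rw [argmaxFrom, show s + k + 1 - s = k + 1 by omega, argmaxFrom, show s + k - s = k by omega]

theorem le_argmaxFrom_and_le (g : ℕ → ℚ) {s t : ℕ} (h : s ≤ t) :
    s ≤ argmaxFrom g s t ∧ argmaxFrom g s t ≤ t := by
  induction t, h using Nat.le_induction with
  | base => simp [argmaxFrom_self]
  | succ t h ih =>
    rw [argmaxFrom_succ g h]
    split_ifs <;> omega

theorem apply_le_apply_argmaxFrom (g : ℕ → ℚ) {s r t : ℕ} (hsr : s ≤ r) (hrt : r ≤ t) :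
    g r ≤ g (argmaxFrom g s t) := by
  induction t, (hsr.trans hrt) using Nat.le_induction with
  | base => rw [argmaxFrom_self, le_antisymm hrt hsr]
  | succ t h ih =>
    rw [argmaxFrom_succ g h]
    rcases Nat.lt_or_eq_of_le hrt with hlt | rfl
    · have := ih (Nat.lt_succ_iff.1 hlt)
      split_ifs with hc
      · exact this.trans hc.le
      · exact this
    · split_ifs with hc
      · exact le_rfl
      · exact not_lt.1 hc

theorem computable_argmaxFrom {X : Type*} [Primcodable X] {G : X → ℕ → ℚ} (hG : Computable₂ G)
    {s t : X → ℕ} (hs : Computable s) (ht : Computable t) :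
    Computable fun x => argmaxFrom (G x) (s x) (t x) := by
  have hpos : Computable fun p : X × ℕ × ℕ => s p.1 + p.2.1 + 1 :=
    Computable.succ.comp ((hs.comp .fst).nat_add' (Computable.fst.comp .snd))
  have hstep : Computable₂ fun (x : X) (p : ℕ × ℕ) =>
      if G x p.2 < G x (s x + p.1 + 1) then s x + p.1 + 1 else p.2 :=
    Computable.ite_pred (ComputablePred.rat_lt (hG.comp .fst (Computable.snd.comp .snd))
      (hG.comp .fst hpos)) hpos (Computable.snd.comp .snd)
  exact Computable.nat_rec (Primrec.nat_sub.to_comp.comp ht hs) hs hstep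

/-- `v t` is the starting stage of a window containing `t`, the windows being consecutive
intervals of stages. -/
def IsWindowStart (v : ℕ → ℕ) : Prop :=
  v 0 = 0 ∧ ∀ t, v (t + 1) = v t ∨ v (t + 1) = t + 1

theorem IsWindowStart.le {v : ℕ → ℕ} (hv : IsWindowStart v) (t : ℕ) : v t ≤ t := by
  induction t with
  | zero => exact hv.1.le
  | succ t ih => rcases hv.2 t with h | h <;> omega

theorem isWindowStart_zero : IsWindowStart fun _ => 0 := ⟨rfl, fun _ => .inl rfl⟩

theorem IsWindowStart.argmaxFrom {v : ℕ → ℕ} (hv : IsWindowStart v) (g : ℕ → ℚ) :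
    IsWindowStart fun t => argmaxFrom g (v t) t := by
  refine ⟨by dsimp only; rw [hv.1, argmaxFrom_self], fun t => ?_⟩
  dsimp only
  rcases hv.2 t with h | h
  · rw [h, argmaxFrom_succ g (hv.le t)]
    split_ifs
    · exact .inr rfl
    · exact .inl rfl
  · rw [h, argmaxFrom_self]
    exact .inr rfl

theorem IsWindowStart.eq_of_argmaxFrom_eq {v : ℕ → ℕ} (hv : IsWindowStart v) (g : ℕ → ℚ) {t : ℕ}
    (h : _root_.argmaxFrom g (v (t + 1)) (t + 1) = _root_.argmaxFrom g (v t) t) :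
    v (t + 1) = v t := by
  rcases hv.2 t with h' | h'
  · exact h'
  · rw [h', argmaxFrom_self] at h
    have := (le_argmaxFrom_and_le g (hv.le t)).2
    omega

/-- The increase of `f` up to stage `N`, not counting the steps into new windows. -/
noncomputable def windowIncrease (v : ℕ → ℕ) (f : ℕ → ℚ) (N : ℕ) : ℚ :=
  ∑ t ∈ Finset.range N, if v (t + 1) = v t then f (t + 1) - f t else 0

theorem windowIncrease_mono {v w : ℕ → ℕ} (h : ∀ t, w (t + 1) = w t → v (t + 1) = v t)
    {f : ℕ → ℚ} (hf : Monotone f) (N : ℕ) : windowIncrease w f N ≤ windowIncrease v f N := by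
  refine Finset.sum_le_sum fun t _ => ?_
  have := sub_nonneg.2 (hf t.le_succ)
  split_ifs with h1 h2 h2
  · exact le_rfl
  · exact absurd (h t h1) h2
  · exact this
  · exact le_rfl

theorem windowIncrease_argmaxFrom_le {v : ℕ → ℕ} (hv : IsWindowStart v) (g : ℕ → ℚ)
    {f : ℕ → ℚ} (hf : Monotone f) (N : ℕ) :
    windowIncrease (fun t => argmaxFrom g (v t) t) f N ≤ windowIncrease v f N :=
  windowIncrease_mono (fun _ => hv.eq_of_argmaxFrom_eq g) hf N

theorem windowIncrease_le_sub (v : ℕ → ℕ) {f : ℕ → ℚ} (hf : Monotone f) (N : ℕ) :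
    windowIncrease v f N ≤ f N - f 0 := by
  rw [← Finset.sum_range_sub]
  refine Finset.sum_le_sum fun t _ => ?_
  have := sub_nonneg.2 (hf t.le_succ)
  split_ifs
  · exact le_rfl
  · exact this

theorem windowIncrease_sub_mul (v : ℕ → ℕ) (f g : ℕ → ℚ) (c : ℚ) (N : ℕ) :
    windowIncrease v (fun t => f t - c * g t) N =
      windowIncrease v f N - c * windowIncrease v g N := by
  rw [windowIncrease, windowIncrease, windowIncrease, Finset.mul_sum, ← Finset.sum_sub_distrib]
  refine Finset.sum_congr rfl fun t _ => ?_
  split_ifs <;> ring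

theorem windowIncrease_le_of_le_start {v : ℕ → ℕ} (hv : IsWindowStart v) {g : ℕ → ℚ}
    (hg : ∀ t, g t ≤ g (v t)) (N : ℕ) : windowIncrease v g N ≤ g N - g (v N) := by
  induction N with
  | zero => simp [windowIncrease, hv.1]
  | succ N ih =>
    rw [windowIncrease, Finset.sum_range_succ, ← windowIncrease]
    have := hg N
    rcases hv.2 N with h | h
    · rw [if_pos h, h]
      linarith
    · rw [if_neg (by have := hv.le N; omega), h]
      linarith

theorem windowIncrease_argmaxFrom_nonpos {v : ℕ → ℕ} (hv : IsWindowStart v) (g : ℕ → ℚ) (N : ℕ) :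
    windowIncrease (fun t => argmaxFrom g (v t) t) g N ≤ 0 := by
  have hg : ∀ t, g t ≤ g (argmaxFrom g (v t) t) := fun t =>
    apply_le_apply_argmaxFrom g (hv.le t) le_rfl
  exact (windowIncrease_le_of_le_start (hv.argmaxFrom g) hg N).trans (sub_nonpos.2 (hg N))

/-- Window starts for windows nested `2 * m` deep, alternating between records of `g` and
records of `h`. -/
noncomputable def nestedStart (g h : ℕ → ℚ) (m t : ℕ) : ℕ :=
  Nat.rec 0 (fun _ r => argmaxFrom h (argmaxFrom g r t) t) m

theorem isWindowStart_nestedStart (g h : ℕ → ℚ) (m : ℕ) : IsWindowStart (nestedStart g h m) := by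
  induction m with
  | zero => exact isWindowStart_zero
  | succ m ih => exact (ih.argmaxFrom g).argmaxFrom h

theorem computable_nestedStart {g h : ℕ → ℚ} (hg : Computable g) (hh : Computable h) :
    Computable₂ (nestedStart g h) := by
  have hstep : Computable₂ fun (p : ℕ × ℕ) (q : ℕ × ℕ) =>
      argmaxFrom h (argmaxFrom g q.2 p.2) p.2 := by
    have ht : Computable fun x : (ℕ × ℕ) × ℕ × ℕ => x.1.2 := Computable.snd.comp .fst
    exact computable_argmaxFrom (hh.comp .snd).to₂
      (computable_argmaxFrom (hg.comp .snd).to₂ (Computable.snd.comp .snd) ht) ht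
  exact Computable.nat_rec Computable.fst (.const 0) hstep

theorem windowIncrease_nestedStart_le {a b : ℕ → ℚ} (ha : Monotone a) (hb : Monotone b)
    {c e K : ℚ} (hc : 0 ≤ c) (he : 0 ≤ e) (hK : ∀ N, a N - a 0 ≤ K) (m N : ℕ) :
    windowIncrease (nestedStart (fun t => a t - c * b t) (fun t => b t - e * a t) (m + 1)) a N ≤
      (c * e) ^ m * K := by
  set g : ℕ → ℚ := fun t => a t - c * b t with hg
  set h : ℕ → ℚ := fun t => b t - e * a t with hh
  induction m with
  | zero => simpa using (windowIncrease_le_sub _ ha N).trans (hK N)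
  | succ m ih =>
    have hs := isWindowStart_nestedStart g h
    have h1 := windowIncrease_argmaxFrom_nonpos (hs (m + 1)) g N
    have h2 := windowIncrease_argmaxFrom_nonpos ((hs m).argmaxFrom g) h N
    rw [hg, windowIncrease_sub_mul, ← hg] at h1
    nth_rw 2 [hh] at h2
    rw [windowIncrease_sub_mul] at h2
    have h3 : windowIncrease (nestedStart g h (m + 2)) a N ≤ _ :=
      windowIncrease_argmaxFrom_le ((hs (m + 1)).argmaxFrom g) h ha N
    have h4 := windowIncrease_argmaxFrom_le (hs (m + 1)) g hb N
    have h5 : windowIncrease (nestedStart g h (m + 1)) b N ≤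
        e * windowIncrease (nestedStart g h (m + 1)) a N := sub_nonpos.1 h2
    have h6 := mul_le_mul_of_nonneg_left (h4.trans h5) hc
    have h7 := mul_le_mul_of_nonneg_left ih (mul_nonneg hc he)
    calc _ ≤ _ := h3
      _ ≤ (c * e) * windowIncrease (nestedStart g h (m + 1)) a N := by linarith
      _ ≤ _ := h7.trans_eq (by ring)

open MeasureTheory Filter Topology in
theorem volume_iUnion_Ioo_le {l r : ℕ → ℝ} {w : ℕ → ℝ} (hw : ∀ t, 0 ≤ w t)
    (h0 : r 0 ≤ l 0) (h : ∀ t, (l (t + 1) = l t ∧ r (t + 1) ≤ r t + w t) ∨ r (t + 1) ≤ l (t + 1))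
    {C : ℝ} (hC : ∀ N, ∑ t ∈ Finset.range N, w t ≤ C) :
    volume (⋃ t, Set.Ioo (l t) (r t)) ≤ ENNReal.ofReal C := by
  have key : ∀ N, volume (Set.accumulate (fun t => Set.Ioo (l t) (r t)) N) ≤
      ENNReal.ofReal (∑ t ∈ Finset.range N, w t) := by
    intro N
    induction N with
    | zero => simp [Set.accumulate_def, h0]
    | succ N ih =>
      have hsub : Set.accumulate (fun t => Set.Ioo (l t) (r t)) (N + 1) ⊆
          Set.accumulate (fun t => Set.Ioo (l t) (r t)) N ∪ Set.Ico (r N) (r N + w N) := by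
        rw [Set.accumulate_succ]
        refine Set.union_subset Set.subset_union_left fun x hx => ?_
        rcases h N with ⟨h1, h2⟩ | h1
        · rcases lt_or_ge x (r N) with hlt | hge
          · exact .inl (Set.subset_accumulate (show x ∈ Set.Ioo (l N) (r N) from
              ⟨h1 ▸ hx.1, hlt⟩))
          · exact .inr ⟨hge, hx.2.trans_le h2⟩
        · exact absurd (hx.1.trans hx.2) (not_lt.2 h1)
      calc _ ≤ _ := measure_mono hsub
        _ ≤ _ := measure_union_le _ _
        _ ≤ ENNReal.ofReal (∑ t ∈ Finset.range N, w t) + ENNReal.ofReal (w N) := by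
          gcongr
          simp
        _ = _ := by
          rw [← ENNReal.ofReal_add (Finset.sum_nonneg fun t _ => hw t) (hw N),
            Finset.sum_range_succ]
  rw [measure_iUnion_eq_iSup_accumulate]
  exact iSup_le fun N => (key N).trans (ENNReal.ofReal_le_ofReal (hC N))

theorem ofReal_half_pow (n : ℕ) : ENNReal.ofReal ((1 / 2) ^ n) = 2 ^ (-(n : ℤ)) := by
  rw [ENNReal.zpow_neg, zpow_natCast, ENNReal.ofReal_pow (by norm_num), one_div,
    ENNReal.ofReal_inv_of_pos two_pos, ENNReal.inv_pow]
  simp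

namespace MLRandom

theorem ne_ratCast {x : ℝ} (hx : MLRandom x) (q : ℚ) : x ≠ q := by
  rintro rfl
  have hr : Computable fun p : ℕ × ℕ => ((1 : ℚ) / 2) ^ p.1 * (1 / 2) :=
    (RatCoding.computable_half_pow.comp .fst).rat_mul (.const _)
  refine hx (fun n _ => (q - (1 / 2) ^ n * (1 / 2), q + (1 / 2) ^ n * (1 / 2)))
    (((Computable.const q).rat_sub hr).pair ((Computable.const q).rat_add hr)) (fun n => ?_) ?_
  · rw [Set.iUnion_const, Real.volume_Ioo, ← ofReal_half_pow]
    refine ENNReal.ofReal_le_ofReal (le_of_eq ?_)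
    push_cast
    ring
  · refine Set.mem_iInter.2 fun n => Set.mem_iUnion.2 ⟨0, ?_⟩
    have : (0 : ℝ) < (1 / 2) ^ n * (1 / 2) := by positivity
    constructor <;> push_cast <;> linarith

/-- A random real escapes some level of a test built from growing windows. -/
theorem exists_forall_notMem_Ioo {x : ℝ} (hx : MLRandom x) {a b : ℕ → ℚ} (ha : Computable a)
    (ham : Monotone a) (hb : Computable b) {v : ℕ → ℕ → ℕ} (hv : Computable₂ v)
    (hvw : ∀ n, IsWindowStart (v n)) {e : ℕ → ℚ} (he : Computable e) (he0 : ∀ n, 0 ≤ e n)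
    (hbound : ∀ n N, e n * windowIncrease (v n) a N ≤ (1 / 2) ^ n) :
    ∃ n, ∀ t, x ∉ Set.Ioo (b (v n t) : ℝ) (b (v n t) + e n * (a t - a (v n t))) := by
  by_contra! hmem
  refine hx (fun n t => (b (v n t), b (v n t) + e n * (a t - a (v n t)))) ?_ (fun n => ?_) ?_
  · have h1 : Computable fun p : ℕ × ℕ => b (v p.1 p.2) := hb.comp hv
    exact h1.pair (h1.rat_add ((he.comp .fst).rat_mul ((ha.comp .snd).rat_sub (ha.comp hv))))
  · rw [← ofReal_half_pow]
    refine volume_iUnion_Ioo_le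
      (w := fun t => ((e n * if v n (t + 1) = v n t then a (t + 1) - a t else 0 : ℚ) : ℝ))
      (fun t => ?_) ?_ (fun t => ?_) fun N => ?_
    · refine Rat.cast_nonneg.2 (mul_nonneg (he0 n) ?_)
      split_ifs
      · exact sub_nonneg.2 (ham t.le_succ)
      · exact le_rfl
    · simp [(hvw n).1]
    · rcases (hvw n).2 t with h | h
      · refine .inl ⟨by rw [h], le_of_eq ?_⟩
        rw [if_pos h, h]
        push_cast
        ring
      · refine .inr (le_of_eq ?_)
        rw [h]
        simp
    · rw [← Rat.cast_sum, ← Finset.mul_sum]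
      have h := hbound n N
      rw [windowIncrease] at h
      exact (Rat.cast_le.2 h).trans_eq (by push_cast; rfl)
  · refine Set.mem_iInter.2 fun n => Set.mem_iUnion.2 ?_
    obtain ⟨t, ht⟩ := hmem n
    exact ⟨t, by simpa using ht⟩

end MLRandom

open Filter Topology

/-- If `g` is infinitely often above its limit, the maximum from a fixed stage on stabilizes
above the limit. -/
theorem eventually_argmaxFrom_eq {g : ℕ → ℚ} {ℓ : ℝ}
    (hg : Tendsto (fun t => (g t : ℝ)) atTop (𝓝 ℓ)) (hf : ∃ᶠ t in atTop, ℓ < g t)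
    {v : ℕ → ℕ} {s : ℕ} (hv : ∀ᶠ t in atTop, v t = s) :
    ∃ w, (∀ᶠ t in atTop, argmaxFrom g (v t) t = w) ∧ ℓ < g w := by
  obtain ⟨k, hsk, hk⟩ := (frequently_atTop.1 hf) s
  obtain ⟨T, hT⟩ := eventually_atTop.1
    ((hv.and (hg.eventually_lt_const hk)).and (eventually_ge_atTop k))
  have hkT : k ≤ T := (hT T le_rfl).2
  have hconst : ∀ t ≥ T, argmaxFrom g s t = argmaxFrom g s T := by
    intro t ht
    induction t, ht using Nat.le_induction with
    | base => rfl
    | succ t ht ih =>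
      have h1 : g (t + 1) < g k := Rat.cast_lt.1 (hT (t + 1) (by omega)).1.2
      have h2 := apply_le_apply_argmaxFrom g hsk (hkT.trans ht)
      rw [argmaxFrom_succ g (by omega), if_neg (not_lt.2 (h1.le.trans h2)), ih]
  refine ⟨argmaxFrom g s T, eventually_atTop.2 ⟨T, fun t ht => ?_⟩, hk.trans_le ?_⟩
  · rw [(hT t ht).1.1, hconst t ht]
  · exact Rat.cast_le.2 (apply_le_apply_argmaxFrom g hsk hkT)

theorem exists_eventually_nestedStart_eq {g h : ℕ → ℚ} {x y : ℝ}
    (hg : Tendsto (fun t => (g t : ℝ)) atTop (𝓝 x)) (hgf : ∃ᶠ t in atTop, x < g t)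
    (hh : Tendsto (fun t => (h t : ℝ)) atTop (𝓝 y)) (hhf : ∃ᶠ t in atTop, y < h t) (m : ℕ) :
    ∃ w, (∀ᶠ t in atTop, nestedStart g h (m + 1) t = w) ∧ y < h w := by
  have hev : ∃ s, ∀ᶠ t in atTop, nestedStart g h m t = s := by
    induction m with
    | zero => exact ⟨0, .of_forall fun _ => rfl⟩
    | succ m ih =>
      obtain ⟨s, hs⟩ := ih
      obtain ⟨s', hs', -⟩ := eventually_argmaxFrom_eq hg hgf hs
      obtain ⟨w, hw, -⟩ := eventually_argmaxFrom_eq hh hhf hs'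
      exact ⟨w, hw⟩
  obtain ⟨s, hs⟩ := hev
  obtain ⟨s', hs', -⟩ := eventually_argmaxFrom_eq hg hgf hs
  exact eventually_argmaxFrom_eq hh hhf hs'

namespace LeftCEApprox

variable {a b a' b' : ℕ → ℚ} {α β : ℝ}

theorem le (ha : LeftCEApprox a α) (s : ℕ) : (a s : ℝ) ≤ α :=
  Monotone.ge_of_tendsto (fun _ _ h => Rat.cast_le.2 (ha.2.1 h)) ha.2.2 s

theorem lt (ha : LeftCEApprox a α) (hα : MLRandom α) (s : ℕ) : (a s : ℝ) < α :=
  (ha.le s).lt_of_ne (hα.ne_ratCast _).symm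

theorem exists_bound (ha : LeftCEApprox a α) : ∃ K : ℕ, 0 < K ∧ ∀ N, a N - a 0 ≤ K := by
  obtain ⟨K, hK⟩ := exists_nat_gt (α - a 0)
  refine ⟨K + 1, K.succ_pos, fun N => ?_⟩
  have h := ha.le N
  rw [← Rat.cast_le (K := ℝ)]
  push_cast
  linarith

theorem tendsto_sub_mul (ha : LeftCEApprox a α) (hb : LeftCEApprox b β) (c : ℚ) :
    Tendsto (fun t => ((a t - c * b t : ℚ) : ℝ)) atTop (𝓝 (α - c * β)) := by
  push_cast
  exact ha.2.2.sub (hb.2.2.const_mul _)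

theorem computable_sub_mul (ha : LeftCEApprox a α) (hb : LeftCEApprox b β) (c : ℚ) :
    Computable fun t => a t - c * b t :=
  ha.1.rat_sub ((Computable.const c).rat_mul hb.1)

/-- A window on which `b - e * a` starts above its limit eventually captures `β`. -/
theorem eventually_mem_Ioo (ha : LeftCEApprox a α) (hb : LeftCEApprox b β) (hβ : MLRandom β)
    {e : ℚ} {v : ℕ → ℕ} {w : ℕ} (hv : ∀ᶠ t in atTop, v t = w)
    (hw : β - e * α < (b w - e * a w : ℚ)) :
    ∀ᶠ t in atTop, β ∈ Set.Ioo (b (v t) : ℝ) (b (v t) + e * (a t - a (v t))) := by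
  have hlim : Tendsto (fun t => (b w + e * (a t - a w) : ℝ)) atTop (𝓝 (b w + e * (α - a w))) :=
    ((ha.2.2.sub_const _).const_mul _).const_add _
  push_cast at hw
  filter_upwards [hv, hlim.eventually_const_lt (show β < _ by linarith)] with t ht hlt
  rw [ht]
  exact ⟨hb.lt hβ w, hlt⟩

theorem not_frequently_and_frequently (ha : LeftCEApprox a α) (hb : LeftCEApprox b β)
    (hβ : MLRandom β) {c e : ℚ} (hc : 0 ≤ c) (he : 0 ≤ e) (hce : c * e < 1) :
    ¬ ((∃ᶠ t in atTop, α - a t < c * (β - b t)) ∧ ∃ᶠ t in atTop, β - b t < e * (α - a t)) := by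
  rintro ⟨h1, h2⟩
  obtain ⟨K, hK0, hK⟩ := ha.exists_bound
  have hce0 : 0 ≤ c * e := mul_nonneg hc he
  obtain ⟨i, hi⟩ := exists_pow_lt_of_lt_one (show (0 : ℚ) < 1 / 2 by norm_num) hce
  obtain ⟨j, hj⟩ := exists_pow_lt_of_lt_one (show (0 : ℚ) < 1 / (e * K + 1) by positivity) hce
  set g : ℕ → ℚ := fun t => a t - c * b t with hg
  set h : ℕ → ℚ := fun t => b t - e * a t with hh
  obtain ⟨n, hn⟩ := hβ.exists_forall_notMem_Ioo ha.1 ha.2.1 hb.1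
    (v := fun n t => nestedStart g h (i * n + j + 1) t) (e := fun _ => e)
    ((computable_nestedStart (ha.computable_sub_mul hb c) (hb.computable_sub_mul ha e)).comp
      (Computable.succ.comp (((Computable.const i).nat_mul' .fst).nat_add' (.const j))) .snd)
    (fun n => isWindowStart_nestedStart g h _) (.const e) (fun _ => he) (fun n N => by
      have hle := windowIncrease_nestedStart_le ha.2.1 hb.2.1 hc he hK (i * n + j) N
      have hpow : ((c * e) ^ i) ^ n ≤ (1 / 2) ^ n :=
        pow_le_pow_left₀ (pow_nonneg hce0 i) hi.le n
      have hone : (c * e) ^ j * (e * K) ≤ 1 := by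
        rw [lt_div_iff₀ (by positivity)] at hj
        nlinarith [pow_nonneg hce0 j]
      calc _ ≤ e * ((c * e) ^ (i * n + j) * K) := mul_le_mul_of_nonneg_left hle he
        _ = ((c * e) ^ i) ^ n * ((c * e) ^ j * (e * K)) := by rw [pow_add, pow_mul]; ring
        _ ≤ (1 / 2) ^ n * 1 := mul_le_mul hpow hone (by positivity) (by positivity)
        _ = _ := mul_one _)
  obtain ⟨w, hw, hlt⟩ := exists_eventually_nestedStart_eq (g := g) (h := h)
    (ha.tendsto_sub_mul hb c)
    (h1.mono fun t ht => by simp only [hg]; push_cast; linarith) (hb.tendsto_sub_mul ha e)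
    (h2.mono fun t ht => by simp only [hh]; push_cast; linarith) (i * n + j)
  obtain ⟨t, ht⟩ := (ha.eventually_mem_Ioo hb hβ hw hlt).exists
  exact hn t ht

/-- A random left-c.e. real is approximated no faster than any other left-c.e. real, up to
a constant factor. -/
theorem exists_eventually_le_mul (ha : LeftCEApprox a α) (hb : LeftCEApprox b β)
    (hβ : MLRandom β) : ∃ C : ℝ, 0 < C ∧ ∀ᶠ t in atTop, α - a t ≤ C * (β - b t) := by
  obtain ⟨K, hK0, hK⟩ := ha.exists_bound
  have hK0' : (0 : ℚ) < K := Nat.cast_pos.2 hK0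
  have he : Computable fun n : ℕ => ((1 : ℚ) / 2) ^ n * (1 / K) :=
    RatCoding.computable_half_pow.rat_mul (.const _)
  obtain ⟨n, hn⟩ := hβ.exists_forall_notMem_Ioo ha.1 ha.2.1 hb.1
    (v := fun n t => argmaxFrom (fun t => b t - (1 / 2) ^ n * (1 / K) * a t) 0 t)
    (computable_argmaxFrom (X := ℕ × ℕ)
      (G := fun p t => b t - (1 / 2) ^ p.1 * (1 / K) * a t)
      ((hb.1.comp .snd).rat_sub ((he.comp (Computable.fst.comp .fst)).rat_mul
        (ha.1.comp .snd))).to₂ (.const 0) .snd)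
    (fun n => isWindowStart_zero.argmaxFrom _) he (fun n => by positivity) (fun n N => by
      have hle := (windowIncrease_le_sub (fun t => argmaxFrom
        (fun t => b t - (1 / 2) ^ n * (1 / K) * a t) 0 t) ha.2.1 N).trans (hK N)
      calc _ ≤ (1 / 2) ^ n * (1 / K) * (K : ℚ) := mul_le_mul_of_nonneg_left hle (by positivity)
        _ = _ := by field_simp)
  set e : ℚ := (1 / 2) ^ n * (1 / K) with he_def
  have he0 : 0 < e := by positivity
  refine ⟨1 / e, by positivity, ?_⟩
  by_contra hfreq
  have hfreq' : ∃ᶠ t in atTop, β - e * α < ((b t - e * a t : ℚ) : ℝ) := by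
    refine (not_eventually.1 hfreq).mono fun t ht => ?_
    have h0 : (0 : ℝ) < e := Rat.cast_pos.2 he0
    rw [not_le, one_div, inv_mul_lt_iff₀ h0] at ht
    push_cast
    linarith
  obtain ⟨w, hw, hlt⟩ := eventually_argmaxFrom_eq (hb.tendsto_sub_mul ha e) hfreq'
    (v := fun _ => 0) (.of_forall fun _ => rfl)
  obtain ⟨t, ht⟩ := (ha.eventually_mem_Ioo hb hβ hw hlt).exists
  exact hn t ht

theorem exists_tendsto_div (ha : LeftCEApprox a α) (hb : LeftCEApprox b β)
    (hα : MLRandom α) (hβ : MLRandom β) :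
    ∃ L : ℝ, 0 < L ∧ Tendsto (fun s => (α - a s) / (β - b s)) atTop (𝓝 L) := by
  have hA : ∀ s, 0 < α - a s := fun s => sub_pos.2 (ha.lt hα s)
  have hB : ∀ s, 0 < β - b s := fun s => sub_pos.2 (hb.lt hβ s)
  obtain ⟨C, -, hC⟩ := ha.exists_eventually_le_mul hb hβ
  obtain ⟨D, hD0, hD⟩ := hb.exists_eventually_le_mul ha hα
  have hlow : ∀ᶠ s in atTop, 1 / D ≤ (α - a s) / (β - b s) := by
    filter_upwards [hD] with s hs
    rw [div_le_div_iff₀ hD0 (hB s)]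
    linarith
  obtain ⟨L, hL⟩ : ∃ L : ℝ, Tendsto (fun s => (α - a s) / (β - b s)) atTop (𝓝 L) := by
    refine tendsto_of_no_upcrossings (s := Set.range ((↑) : ℚ → ℝ)) Rat.denseRange_cast ?_ ?_ ?_
    · rintro _ ⟨c, rfl⟩ _ ⟨d, rfl⟩ hcd ⟨h1, h2⟩
      have hc : 0 < c := by
        obtain ⟨s, hs⟩ := h1.exists
        exact Rat.cast_pos.1 ((div_pos (hA s) (hB s)).trans hs)
      have hd : 0 < d := hc.trans (Rat.cast_lt.1 hcd)
      refine ha.not_frequently_and_frequently hb hβ hc.le (e := 1 / d) (by positivity) ?_ ⟨?_, ?_⟩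
      · rw [mul_one_div, div_lt_one hd]
        exact Rat.cast_lt.1 hcd
      · exact h1.mono fun s hs => (div_lt_iff₀ (hB s)).1 hs
      · refine h2.mono fun s hs => ?_
        have := (lt_div_iff₀ (hB s)).1 hs
        have hd' : (0 : ℝ) < d := Rat.cast_pos.2 hd
        push_cast
        rw [one_div, lt_inv_mul_iff₀ hd']
        exact this
    · refine isBoundedUnder_of_eventually_le (a := C) ?_
      filter_upwards [hC] with s hs
      exact (div_le_iff₀ (hB s)).2 hs
    · exact isBoundedUnder_of_eventually_ge hlow
  exact ⟨L, (by positivity : 0 < 1 / D).trans_le (ge_of_tendsto hL hlow), hL⟩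

/-- Alternates between `(a, b)` and `(a', b')`, switching whenever both coordinates of the other
pair have caught up; the Boolean records the pair the current value was taken from. -/
noncomputable def merge (a b a' b' : ℕ → ℚ) (s : ℕ) : Bool × ℚ × ℚ :=
  Nat.rec (true, a 0, b 0)
    (fun s p => cond p.1
      (if a' s < p.2.1 then p else if b' s < p.2.2 then p else (false, a' s, b' s))
      (if a s < p.2.1 then p else if b s < p.2.2 then p else (true, a s, b s))) s

theorem merge_succ (a b a' b' : ℕ → ℚ) (s : ℕ) :
    merge a b a' b' (s + 1) = cond (merge a b a' b' s).1
      (if a' s < (merge a b a' b' s).2.1 then merge a b a' b' s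
        else if b' s < (merge a b a' b' s).2.2 then merge a b a' b' s else (false, a' s, b' s))
      (if a s < (merge a b a' b' s).2.1 then merge a b a' b' s
        else if b s < (merge a b a' b' s).2.2 then merge a b a' b' s else (true, a s, b s)) :=
  rfl

theorem merge_succ_cases (a b a' b' : ℕ → ℚ) (s : ℕ) :
    merge a b a' b' (s + 1) = merge a b a' b' s ∨
      (merge a b a' b' s).2 ≤ (merge a b a' b' (s + 1)).2 ∧
      (merge a b a' b' (s + 1) = (true, a s, b s) ∨
        merge a b a' b' (s + 1) = (false, a' s, b' s)) := by
  rw [merge_succ]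
  cases (merge a b a' b' s).1 <;> simp only [cond_true, cond_false] <;> split_ifs with h1 h2 <;>
    simp_all [Prod.le_def]

theorem monotone_merge (a b a' b' : ℕ → ℚ) : Monotone fun s => (merge a b a' b' s).2 :=
  monotone_nat_of_le_succ fun s => by
    rcases merge_succ_cases a b a' b' s with h | h
    · rw [h]
    · exact h.1

theorem computable_ite_lt_ite_lt {f g : ℕ → ℚ} (hf : Computable f) (hg : Computable g) (i : Bool) :
    Computable₂ fun (s : ℕ) (p : Bool × ℚ × ℚ) =>
      if f s < p.2.1 then p else if g s < p.2.2 then p else (i, f s, g s) := by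
  have hp : Computable fun z : ℕ × Bool × ℚ × ℚ => z.2 := .snd
  have hf' : Computable fun z : ℕ × Bool × ℚ × ℚ => f z.1 := hf.comp .fst
  have hg' : Computable fun z : ℕ × Bool × ℚ × ℚ => g z.1 := hg.comp .fst
  exact Computable.ite_pred (ComputablePred.rat_lt hf' (Computable.fst.comp (.comp .snd hp))) hp
    (Computable.ite_pred (ComputablePred.rat_lt hg' (Computable.snd.comp (.comp .snd hp))) hp
      ((Computable.const i).pair (hf'.pair hg')))

theorem computable_merge (ha : Computable a) (hb : Computable b) (ha' : Computable a')
    (hb' : Computable b') : Computable (merge a b a' b') := by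
  have hstep : Computable₂ fun (s : ℕ) (p : Bool × ℚ × ℚ) => cond p.1
      (if a' s < p.2.1 then p else if b' s < p.2.2 then p else (false, a' s, b' s))
      (if a s < p.2.1 then p else if b s < p.2.2 then p else (true, a s, b s)) :=
    (Computable.fst.comp Computable.snd).cond (computable_ite_lt_ite_lt ha' hb' false)
      (computable_ite_lt_ite_lt ha hb true)
  generalize hF : (fun (s : ℕ) (p : Bool × ℚ × ℚ) => cond p.1
      (if a' s < p.2.1 then p else if b' s < p.2.2 then p else (false, a' s, b' s))
      (if a s < p.2.1 then p else if b s < p.2.2 then p else (true, a s, b s))) = F at hstep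
  have hstep' : Computable₂ fun (_ : ℕ) (z : ℕ × Bool × ℚ × ℚ) => F z.1 z.2 :=
    hstep.comp (Computable.fst.comp .snd) (Computable.snd.comp .snd)
  refine (Computable.nat_rec Computable.id (.const (true, a 0, b 0)) hstep').of_eq fun n => ?_
  rw [← hF]
  rfl

theorem merge_lt (ha : ∀ s, (a s : ℝ) < α) (hb : ∀ s, (b s : ℝ) < β) (ha' : ∀ s, (a' s : ℝ) < α)
    (hb' : ∀ s, (b' s : ℝ) < β) (s : ℕ) :
    ((merge a b a' b' s).2.1 : ℝ) < α ∧ ((merge a b a' b' s).2.2 : ℝ) < β := by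
  induction s with
  | zero => exact ⟨ha 0, hb 0⟩
  | succ s ih =>
    rcases merge_succ_cases a b a' b' s with h | ⟨-, h | h⟩
    · rwa [h]
    · rw [h]
      exact ⟨ha s, hb s⟩
    · rw [h]
      exact ⟨ha' s, hb' s⟩

theorem frequently_merge_eq (ha : LeftCEApprox a α) (hb : LeftCEApprox b β)
    (ha' : LeftCEApprox a' α) (hb' : LeftCEApprox b' β) (hα : MLRandom α) (hβ : MLRandom β) :
    (∃ᶠ s in atTop, merge a b a' b' (s + 1) = (true, a s, b s)) ∧
      ∃ᶠ s in atTop, merge a b a' b' (s + 1) = (false, a' s, b' s) := by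
  set m := merge a b a' b' with hm
  have hlt := merge_lt (ha.lt hα) (hb.lt hβ) (ha'.lt hα) (hb'.lt hβ)
  have hcatch : ∀ {f g : ℕ → ℚ}, LeftCEApprox f α → LeftCEApprox g β → ∀ N,
      ∃ s ≥ N, ¬ f s < (m N).2.1 ∧ ¬ g s < (m N).2.2 := fun hf hg N => by
    obtain ⟨s, ⟨h1, h2⟩, h3⟩ := (((hf.2.2.eventually_const_lt (hlt N).1).and
      (hg.2.2.eventually_const_lt (hlt N).2)).and (eventually_ge_atTop N)).exists
    exact ⟨s, h3, not_lt.2 (Rat.cast_lt.1 h1).le, not_lt.2 (Rat.cast_lt.1 h2).le⟩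
  have hstuck : ∀ N, (∀ s ≥ N, m s = m N → m (s + 1) = m s) → ∀ s ≥ N, m s = m N :=
    fun N h s hs => by
      induction s, hs using Nat.le_induction with
      | base => rfl
      | succ s hs ih => exact (h s hs ih).trans ih
  have htf : ∀ N, (m N).1 = true → ∃ s ≥ N, m (s + 1) = (false, a' s, b' s) := by
    intro N hN
    by_contra! hne
    have hst := hstuck N fun s hs h => by
      have h' := hne s hs
      have h1 : (m s).1 = true := by rw [h, hN]
      rw [hm, merge_succ, ← hm, h1, cond_true] at h' ⊢
      split_ifs at h' ⊢ <;> simp_all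
    obtain ⟨s, hs, h1, h2⟩ := hcatch ha' hb' N
    refine hne s hs ?_
    rw [hm, merge_succ, ← hm, hst s hs, hN, cond_true, if_neg h1, if_neg h2]
  have hft : ∀ N, (m N).1 = false → ∃ s ≥ N, m (s + 1) = (true, a s, b s) := by
    intro N hN
    by_contra! hne
    have hst := hstuck N fun s hs h => by
      have h' := hne s hs
      have h1 : (m s).1 = false := by rw [h, hN]
      rw [hm, merge_succ, ← hm, h1, cond_false] at h' ⊢
      split_ifs at h' ⊢ <;> simp_all
    obtain ⟨s, hs, h1, h2⟩ := hcatch ha hb N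
    refine hne s hs ?_
    rw [hm, merge_succ, ← hm, hst s hs, hN, cond_false, if_neg h1, if_neg h2]
  constructor <;> refine frequently_atTop.2 fun N => ?_
  · cases hN : (m N).1 with
    | false => exact hft N hN
    | true =>
      obtain ⟨s, hs, h⟩ := htf N hN
      obtain ⟨r, hr, h'⟩ := hft (s + 1) (by rw [h])
      exact ⟨r, by omega, h'⟩
  · cases hN : (m N).1 with
    | true => exact htf N hN
    | false =>
      obtain ⟨s, hs, h⟩ := hft N hN
      obtain ⟨r, hr, h'⟩ := htf (s + 1) (by rw [h])
      exact ⟨r, by omega, h'⟩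

theorem eq_of_frequently_eq {u v : ℕ → ℝ} {x y : ℝ} (hu : Tendsto u atTop (𝓝 x))
    (hv : Tendsto v atTop (𝓝 y)) (h : ∃ᶠ s in atTop, u (s + 1) = v s) : x = y := by
  obtain ⟨φ, hφ, heq⟩ := extraction_of_frequently_atTop h
  have hu' := ((tendsto_add_atTop_iff_nat 1).2 hu).comp hφ.tendsto_atTop
  exact tendsto_nhds_unique (hu'.congr heq) (hv.comp hφ.tendsto_atTop)

theorem of_frequently_eq {f : ℕ → ℚ} (ha : LeftCEApprox a α) (hf : Computable f)
    (hfm : Monotone f) (hlt : ∀ s, (f s : ℝ) < α) (h : ∃ᶠ s in atTop, f (s + 1) = a s) :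
    LeftCEApprox f α := by
  have hlim := tendsto_atTop_ciSup (f := fun s => (f s : ℝ))
    (fun _ _ h => Rat.cast_le.2 (hfm h)) ⟨α, Set.forall_mem_range.2 fun s => (hlt s).le⟩
  refine ⟨hf, hfm, ?_⟩
  rwa [eq_of_frequently_eq hlim ha.2.2 (h.mono fun s hs => by rw [hs])] at hlim

theorem eq_of_tendsto_div (ha : LeftCEApprox a α) (hb : LeftCEApprox b β)
    (ha' : LeftCEApprox a' α) (hb' : LeftCEApprox b' β) (hα : MLRandom α) (hβ : MLRandom β)
    {L L' : ℝ} (hL : Tendsto (fun s => (α - a s) / (β - b s)) atTop (𝓝 L))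
    (hL' : Tendsto (fun s => (α - a' s) / (β - b' s)) atTop (𝓝 L')) : L = L' := by
  have hlt := merge_lt (ha.lt hα) (hb.lt hβ) (ha'.lt hα) (hb'.lt hβ)
  have hcomp := computable_merge ha.1 hb.1 ha'.1 hb'.1
  have hmono := monotone_merge a b a' b'
  obtain ⟨h1, h2⟩ := frequently_merge_eq ha hb ha' hb' hα hβ
  have hA : LeftCEApprox (fun s => (merge a b a' b' s).2.1) α :=
    ha.of_frequently_eq (Computable.fst.comp (Computable.snd.comp hcomp))
      (fun _ _ h => (hmono h).1) (fun s => (hlt s).1) (h1.mono fun s hs => by rw [hs])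
  have hB : LeftCEApprox (fun s => (merge a b a' b' s).2.2) β :=
    hb.of_frequently_eq (Computable.snd.comp (Computable.snd.comp hcomp))
      (fun _ _ h => (hmono h).2) (fun s => (hlt s).2) (h1.mono fun s hs => by rw [hs])
  obtain ⟨M, -, hM⟩ := hA.exists_tendsto_div hB hα hβ
  exact (eq_of_frequently_eq hM hL (h1.mono fun s hs => by rw [hs])).symm.trans
    (eq_of_frequently_eq hM hL' (h2.mono fun s hs => by rw [hs]))

end LeftCEApprox

/-- For Martin-Löf random left-c.e. reals α, β, the limit
lim_s (α − α_s)/(β − β_s) exists, is positive, and is independent of the chosen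
left-c.e. approximations. -/
theorem stmt_10 (α β : ℝ) (hαl : LeftCE α) (hβl : LeftCE β)
    (hαr : MLRandom α) (hβr : MLRandom β) :
    ∃ L : ℝ, 0 < L ∧ ∀ a b : ℕ → ℚ, LeftCEApprox a α → LeftCEApprox b β →
      Filter.Tendsto (fun s => (α - (a s : ℝ)) / (β - (b s : ℝ)))
        Filter.atTop (nhds L) := by
  obtain ⟨a₀, ha₀⟩ := hαl
  obtain ⟨b₀, hb₀⟩ := hβl
  obtain ⟨L, hL0, hL⟩ := ha₀.exists_tendsto_div hb₀ hαr hβr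
  refine ⟨L, hL0, fun a b ha hb => ?_⟩
  obtain ⟨L', -, hL'⟩ := ha.exists_tendsto_div hb hαr hβr
  rwa [ha₀.eq_of_tendsto_div hb₀ ha hb hαr hβr hL hL']
end

section
/- Let α and β be Martin-Löf random left-c.e. reals and let D(α,β) = lim_s (α − α_s)/(β − β_s), taken along any left-c.e. approximations (α_s) → α and (β_s) → β (this limit exists and is independent of the approximations). Then D(α,β) equals the infimum of all rationals q such that qβ − α is a left-c.e. real, and also equals the supremum of all rationals p such that pβ − α is a right-c.e. real. -/
open scoped Classical

/-- The code of the fraction `q.num / q.den` under the pairing function. -/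
def fracCode (q : ℚ) : ℕ := Nat.pair (Equiv.intEquivNat q.num) q.den

/-- The natural numbers of the form `fracCode q`. -/
def IsFracCode (n : ℕ) : Prop :=
  0 < n.unpair.2 ∧ ((n.unpair.1 + 1) / 2).Coprime n.unpair.2

lemma natAbs_intEquivNat_symm (c : ℕ) : (Equiv.intEquivNat.symm c).natAbs = (c + 1) / 2 := by
  obtain ⟨z, rfl⟩ := Equiv.intEquivNat.surjective c
  rw [Equiv.symm_apply_apply]
  cases z with
  | ofNat n =>
    change n = (2 * n + 1) / 2
    omega
  | negSucc n =>
    change n + 1 = (2 * n + 1 + 1) / 2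
    omega

lemma mem_range_fracCode (n : ℕ) : n ∈ Set.range fracCode ↔ IsFracCode n := by
  constructor
  · rintro ⟨q, rfl⟩
    have h := natAbs_intEquivNat_symm (Equiv.intEquivNat q.num)
    rw [Equiv.symm_apply_apply] at h
    simp only [IsFracCode, fracCode, Nat.unpair_pair, ← h]
    exact ⟨q.den_pos, q.reduced⟩
  · rintro ⟨h0, h1⟩
    rw [← natAbs_intEquivNat_symm] at h1
    refine ⟨⟨Equiv.intEquivNat.symm n.unpair.1, n.unpair.2, h0.ne', h1⟩, ?_⟩
    simp [fracCode]

/-- The position of `q` in the enumeration of `ℚ` underlying its `Primcodable` instance. -/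
def ratIndex (q : ℚ) : ℕ := (Primcodable.toEncodable (α := ℚ)).encode q

lemma ratIndex_eq_count (q : ℚ) : ratIndex q = Nat.count IsFracCode (fracCode q) := by
  have hp : (fun n => n ∈ Set.range (@Encodable.encode ℚ Rat.instEncodable)) = IsFracCode :=
    funext fun n => propext (mem_range_fracCode n)
  rw [← hp, Nat.count]
  change List.countP _ (List.range (fracCode q)) = _
  congr!

lemma primrecPred_isFracCode : PrimrecPred IsFracCode := by
  have hd : PrimrecRel fun k p : ℕ => ¬ (p.unpair.1 % k = 0 ∧ p.unpair.2 % k = 0) ∨ k = 1 := by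
    have hu : Primrec fun x : ℕ × ℕ => x.2.unpair := Primrec.unpair.comp Primrec.snd
    refine PrimrecPred.or (PrimrecPred.not (PrimrecPred.and ?_ ?_)) ?_
    · exact Primrec.eq.comp (Primrec.nat_mod.comp (Primrec.fst.comp hu) Primrec.fst)
        (Primrec.const 0)
    · exact Primrec.eq.comp (Primrec.nat_mod.comp (Primrec.snd.comp hu) Primrec.fst)
        (Primrec.const 0)
    · exact Primrec.eq.comp Primrec.fst (Primrec.const 1)
  have hsnd : Primrec fun n : ℕ => n.unpair.2 := Primrec.snd.comp Primrec.unpair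
  have hfst : Primrec fun n : ℕ => (n.unpair.1 + 1) / 2 :=
    Primrec.nat_div.comp (Primrec.succ.comp (Primrec.fst.comp Primrec.unpair)) (Primrec.const 2)
  refine ((Primrec.nat_lt.comp (Primrec.const 0) hsnd).and
    (hd.forall_lt.comp (Primrec.succ.comp hsnd) (Primrec₂.natPair.comp hfst hsnd))).of_eq fun n => ?_
  simp only [Nat.unpair_pair]
  refine and_congr_right fun hpos => ⟨fun h => ?_, fun h k _ => ?_⟩
  · exact (h _ (Nat.lt_succ_of_le (Nat.gcd_le_right _ hpos))).resolve_left fun hn => hn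
      ⟨Nat.mod_eq_zero_of_dvd (Nat.gcd_dvd_left _ _),
        Nat.mod_eq_zero_of_dvd (Nat.gcd_dvd_right _ _)⟩
  · rw [or_iff_not_imp_left, not_not]
    exact fun hk => Nat.eq_one_of_dvd_coprimes h (Nat.dvd_of_mod_eq_zero hk.1)
      (Nat.dvd_of_mod_eq_zero hk.2)

lemma PrimrecPred.primrec_count {p : ℕ → Prop} [DecidablePred p] (hp : PrimrecPred p) :
    Primrec (Nat.count p) := by
  refine (Primrec.nat_rec₁ (f := fun n c => if p n then c + 1 else c) 0
    (Primrec.ite (hp.comp Primrec.fst) (Primrec.succ.comp Primrec.snd) Primrec.snd)).of_eq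
      fun n => ?_
  induction n with
  | zero => simp
  | succ n ih =>
    simp only [ih, Nat.count_succ]
    split_ifs <;> rfl

/-- A total function is computable if its graph is. -/
lemma computable_of_graph {γ : Type*} [Primcodable γ] {f : γ → ℕ} {g : γ → ℕ → Bool}
    (hg : Computable₂ g) (h : ∀ x n, g x n = true ↔ n = f x) : Computable f := by
  refine (Partrec.rfind hg.partrec₂).of_eq_tot fun x => ?_
  rw [Nat.mem_rfind]
  refine ⟨by simpa using ((h x _).2 rfl).symm, fun {m} hm => ?_⟩
  have := mt (h x m).1 hm.ne
  simpa using this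

lemma computable_fracCode : Computable fracCode := by
  have hc := primrecPred_isFracCode.primrec_count
  have hp : PrimrecPred fun x : ℚ × ℕ =>
      IsFracCode x.2 ∧ Nat.count IsFracCode x.2 = ratIndex x.1 :=
    (primrecPred_isFracCode.comp Primrec.snd).and
      (Primrec.eq.comp (hc.comp Primrec.snd) (Primrec.encode.comp Primrec.fst))
  refine computable_of_graph (g := fun q n =>
      decide (IsFracCode n ∧ Nat.count IsFracCode n = ratIndex q))
    (primrecPred_iff_primrec_decide.1 hp).to_comp fun q n => ?_
  rw [decide_eq_true_iff, ratIndex_eq_count]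
  constructor
  · rintro ⟨h1, h2⟩
    exact Nat.count_injective h1 ((mem_range_fracCode _).1 ⟨q, rfl⟩) h2
  · rintro rfl
    exact ⟨(mem_range_fracCode _).1 ⟨q, rfl⟩, rfl⟩

lemma computable_num_toNat : Computable fun q : ℚ => q.num.toNat := by
  have h : Primrec fun n : ℕ => if n.unpair.1 % 2 = 0 then n.unpair.1 / 2 else 0 :=
    Primrec.ite (Primrec.eq.comp (Primrec.nat_mod.comp (Primrec.fst.comp Primrec.unpair)
        (Primrec.const 2)) (Primrec.const 0))
      (Primrec.nat_div.comp (Primrec.fst.comp Primrec.unpair) (Primrec.const 2)) (Primrec.const 0)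
  refine (h.to_comp.comp computable_fracCode).of_eq fun q => ?_
  simp only [fracCode, Nat.unpair_pair]
  cases q.num with
  | ofNat n =>
    change (if 2 * n % 2 = 0 then 2 * n / 2 else 0) = n
    simp
  | negSucc n =>
    change (if (2 * n + 1) % 2 = 0 then (2 * n + 1) / 2 else 0) = 0
    rw [if_neg (by omega)]

lemma computable_neg_num_toNat : Computable fun q : ℚ => (-q.num).toNat := by
  have h : Primrec fun n : ℕ => if n.unpair.1 % 2 = 0 then 0 else (n.unpair.1 + 1) / 2 :=
    Primrec.ite (Primrec.eq.comp (Primrec.nat_mod.comp (Primrec.fst.comp Primrec.unpair)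
        (Primrec.const 2)) (Primrec.const 0)) (Primrec.const 0)
      (Primrec.nat_div.comp (Primrec.succ.comp (Primrec.fst.comp Primrec.unpair))
        (Primrec.const 2))
  refine (h.to_comp.comp computable_fracCode).of_eq fun q => ?_
  simp only [fracCode, Nat.unpair_pair]
  cases q.num with
  | ofNat n =>
    change (if 2 * n % 2 = 0 then 0 else (2 * n + 1) / 2) = (-(n : ℤ)).toNat
    simp
  | negSucc n =>
    change (if (2 * n + 1) % 2 = 0 then 0 else (2 * n + 1 + 1) / 2) = n + 1
    rw [if_neg (by omega)]
    omega

lemma computable_den : Computable fun q : ℚ => q.den := by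
  have h : Primrec fun n : ℕ => n.unpair.2 := Primrec.snd.comp Primrec.unpair
  exact (h.to_comp.comp computable_fracCode).of_eq fun q => by simp [fracCode]

lemma rat_eq_toNat_sub_div (q : ℚ) :
    q = ((q.num.toNat : ℚ) - ((-q.num).toNat : ℚ)) / (q.den : ℚ) := by
  have h : (q.num : ℚ) = (q.num.toNat : ℚ) - ((-q.num).toNat : ℚ) := by
    have h' : q.num = (q.num.toNat : ℤ) - ((-q.num).toNat : ℤ) := by omega
    exact_mod_cast congrArg (Int.cast : ℤ → ℚ) h'
  rw [← h, Rat.num_div_den]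

section

variable {γ : Type*} [Primcodable γ]

lemma Computable.nat_add {f g : γ → ℕ} (hf : Computable f) (hg : Computable g) :
    Computable fun x => f x + g x :=
  Primrec.nat_add.to_comp.comp hf hg

lemma Computable.nat_mul {f g : γ → ℕ} (hf : Computable f) (hg : Computable g) :
    Computable fun x => f x * g x :=
  Primrec.nat_mul.to_comp.comp hf hg

lemma Computable.decide_nat_eq {f g : γ → ℕ} (hf : Computable f) (hg : Computable g) :
    Computable fun x => decide (f x = g x) :=
  (primrecRel_iff_primrec_decide.1 (Primrec.eq (α := ℕ))).to_comp.comp hf hg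

lemma Computable.decide_nat_lt {f g : γ → ℕ} (hf : Computable f) (hg : Computable g) :
    Computable fun x => decide (f x < g x) :=
  (primrecRel_iff_primrec_decide.1 Primrec.nat_lt).to_comp.comp hf hg

lemma sub_div_eq_sub_div_iff {p m d p' m' d' : ℕ} (hd : 0 < d) (hd' : 0 < d') :
    ((p : ℚ) - m) / d = ((p' : ℚ) - m') / d' ↔ p * d' + m' * d = p' * d + m * d' := by
  have h1 : (d : ℚ) ≠ 0 := by positivity
  have h2 : (d' : ℚ) ≠ 0 := by positivity
  rw [div_eq_div_iff h1 h2, ← Nat.cast_inj (R := ℚ)]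
  push_cast
  constructor <;> intro h <;> linarith

/-- A rational-valued function given as a computable fraction is computable. -/
lemma computable_of_frac {f : γ → ℚ} {P M D : γ → ℕ} (hP : Computable P) (hM : Computable M)
    (hD : Computable D) (hD0 : ∀ x, 0 < D x)
    (hf : ∀ x, f x = ((P x : ℚ) - (M x : ℚ)) / (D x : ℚ)) : Computable f := by
  have hr : Computable fun x : γ × ℕ => Denumerable.ofNat ℚ x.2 :=
    (Primrec.ofNat ℚ).to_comp.comp Computable.snd
  have hp := computable_num_toNat.comp hr
  have hm := computable_neg_num_toNat.comp hr
  have hd := computable_den.comp hr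
  refine Computable.encode_iff.1 (computable_of_graph (Computable.decide_nat_eq
    ((hp.nat_mul (hD.comp Computable.fst)).nat_add ((hM.comp Computable.fst).nat_mul hd))
    (((hP.comp Computable.fst).nat_mul hd).nat_add (hm.nat_mul (hD.comp Computable.fst)))).to₂
    fun x n => ?_)
  rw [decide_eq_true_iff, ← sub_div_eq_sub_div_iff (Rat.den_pos _) (hD0 x),
    ← rat_eq_toNat_sub_div, ← hf]
  constructor
  · intro h
    rw [← h]
    exact (Denumerable.encode_ofNat n).symm
  · rintro rfl
    exact Denumerable.ofNat_encode (f x)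

lemma Computable.rat_mul_s11 {f g : γ → ℚ} (hf : Computable f) (hg : Computable g) :
    Computable fun x => f x * g x := by
  have p1 := computable_num_toNat.comp hf
  have m1 := computable_neg_num_toNat.comp hf
  have d1 := computable_den.comp hf
  have p2 := computable_num_toNat.comp hg
  have m2 := computable_neg_num_toNat.comp hg
  have d2 := computable_den.comp hg
  refine computable_of_frac ((p1.nat_mul p2).nat_add (m1.nat_mul m2))
    ((p1.nat_mul m2).nat_add (m1.nat_mul p2)) (d1.nat_mul d2)
    (fun x => Nat.mul_pos (Rat.den_pos _) (Rat.den_pos _)) fun x => ?_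
  conv_lhs => rw [rat_eq_toNat_sub_div (f x), rat_eq_toNat_sub_div (g x)]
  rw [div_mul_div_comm]
  push_cast
  congr 1
  ring

lemma Computable.rat_sub_s11 {f g : γ → ℚ} (hf : Computable f) (hg : Computable g) :
    Computable fun x => f x - g x := by
  have p1 := computable_num_toNat.comp hf
  have m1 := computable_neg_num_toNat.comp hf
  have d1 := computable_den.comp hf
  have p2 := computable_num_toNat.comp hg
  have m2 := computable_neg_num_toNat.comp hg
  have d2 := computable_den.comp hg
  refine computable_of_frac ((p1.nat_mul d2).nat_add (m2.nat_mul d1))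
    ((m1.nat_mul d2).nat_add (p2.nat_mul d1)) (d1.nat_mul d2)
    (fun x => Nat.mul_pos (Rat.den_pos _) (Rat.den_pos _)) fun x => ?_
  have h1 : ((f x).den : ℚ) ≠ 0 := by simp
  have h2 : ((g x).den : ℚ) ≠ 0 := by simp
  conv_lhs => rw [rat_eq_toNat_sub_div (f x), rat_eq_toNat_sub_div (g x)]
  rw [div_sub_div _ _ h1 h2]
  push_cast
  congr 1
  ring

lemma Computable.rat_add_s11 {f g : γ → ℚ} (hf : Computable f) (hg : Computable g) :
    Computable fun x => f x + g x :=
  (hf.rat_sub_s11 ((Computable.const 0).rat_sub_s11 hg)).of_eq fun x => by ring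

lemma Computable.decide_rat_lt {f g : γ → ℚ} (hf : Computable f) (hg : Computable g) :
    Computable fun x => decide (f x < g x) := by
  have p1 := computable_num_toNat.comp hf
  have m1 := computable_neg_num_toNat.comp hf
  have d1 := computable_den.comp hf
  have p2 := computable_num_toNat.comp hg
  have m2 := computable_neg_num_toNat.comp hg
  have d2 := computable_den.comp hg
  refine (Computable.decide_nat_lt ((p1.nat_mul d2).nat_add (m2.nat_mul d1))
    ((p2.nat_mul d1).nat_add (m1.nat_mul d2))).of_eq fun x => ?_
  have h1 : (0 : ℚ) < (f x).den := by exact_mod_cast (f x).den_pos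
  have h2 : (0 : ℚ) < (g x).den := by exact_mod_cast (g x).den_pos
  rw [decide_eq_decide]
  conv_rhs => rw [rat_eq_toNat_sub_div (f x), rat_eq_toNat_sub_div (g x),
    div_lt_div_iff₀ h1 h2]
  rw [← Nat.cast_lt (α := ℚ)]
  push_cast
  constructor <;> intro h <;> linarith

lemma Computable.rat_max {f g : γ → ℚ} (hf : Computable f) (hg : Computable g) :
    Computable fun x => max (f x) (g x) := by
  refine (Computable.cond (hf.decide_rat_lt hg) hg hf).of_eq fun x => ?_
  by_cases h : f x < g x
  · simp [h, max_eq_right h.le]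
  · simp [h, max_eq_left (not_lt.1 h)]

end

lemma Computable.rat_partialSups {f : ℕ → ℚ} (hf : Computable f) :
    Computable (partialSups f) := by
  refine (Computable.nat_rec (f := fun n : ℕ => n) (g := fun _ => f 0)
    (h := fun _ x => max x.2 (f (x.1 + 1))) Computable.id (Computable.const _)
    ((Computable.snd.comp Computable.snd).rat_max (hf.comp (Computable.succ.comp
      (Computable.fst.comp Computable.snd)))).to₂).of_eq fun n => ?_
  induction n with
  | zero => simp
  | succ n ih => simp only [ih, partialSups_add_one]

lemma computable_inv_two_pow : Computable fun n : ℕ => (1 / 2 ^ n : ℚ) := by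
  have hpow : Primrec fun n : ℕ => 2 ^ n :=
    (Primrec.nat_rec₁ (f := fun _ c => c * 2) 1
      (Primrec.nat_mul.comp Primrec.snd (Primrec.const 2))).of_eq fun n => by
        induction n with
        | zero => rfl
        | succ n ih => simp only [ih, pow_succ]
  exact computable_of_frac (Computable.const 1) (Computable.const 0) hpow.to_comp
    (fun n => by positivity) fun n => by simp

/-- A limit from below, not necessarily monotone, of computable rationals is left-c.e. -/
lemma LeftCE.of_eventually_le {f : ℕ → ℚ} {x : ℝ} (hf : Computable f)
    (hlim : Filter.Tendsto (fun n => (f n : ℝ)) Filter.atTop (nhds x))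
    (hle : ∀ᶠ n in Filter.atTop, (f n : ℝ) ≤ x) : LeftCE x := by
  obtain ⟨N, hN⟩ := Filter.eventually_atTop.1 hle
  have hg : Computable fun n => f (N + n) :=
    hf.comp ((Computable.const N).nat_add Computable.id)
  have hglim : Filter.Tendsto (fun n => (f (N + n) : ℝ)) Filter.atTop (nhds x) :=
    hlim.comp (Filter.tendsto_atTop_mono (fun n => Nat.le_add_left n N) Filter.tendsto_id)
  refine ⟨partialSups fun n => f (N + n), hg.rat_partialSups, (partialSups _).monotone,
    tendsto_of_tendsto_of_tendsto_of_le_of_le hglim tendsto_const_nhds (fun n => ?_)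
      (fun n => ?_)⟩
  · exact Rat.cast_le.2 (le_partialSups (fun n => f (N + n)) n)
  · obtain ⟨m, -, hm⟩ := exists_partialSups_eq (fun n => f (N + n)) n
    simp only [hm]
    exact hN _ (Nat.le_add_right _ _)

/-- A real that can be computed to within known error bounds is not random. -/
lemma not_mlRandom_of_sub_le {x : ℝ} {b u : ℕ → ℚ} (hb : Computable b) (hu : Computable u)
    (hbx : ∀ n, (b n : ℝ) ≤ x) (hulim : Filter.Tendsto (fun n => (u n : ℝ)) Filter.atTop (nhds 0))
    (hle : ∀ᶠ n in Filter.atTop, x - (b n : ℝ) ≤ u n) : ¬ MLRandom x := by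
  intro hx
  obtain ⟨N, hN⟩ := Filter.eventually_atTop.1 hle
  let ε : ℕ → ℚ := fun n => 1 / 2 ^ (n + 2)
  have hε0 : ∀ n, (0 : ℝ) < ε n := fun n => by
    simp only [ε]
    positivity
  let I : ℕ → ℕ → ℚ × ℚ := fun n k =>
    bif decide (u (N + k) < ε n) then (b (N + k) - ε n, b (N + k) + ε n) else (0, 0)
  have hI : Computable₂ I := by
    have hk : Computable fun p : ℕ × ℕ => N + p.2 := (Computable.const N).nat_add Computable.snd
    have hε : Computable fun p : ℕ × ℕ => ε p.1 :=
      computable_inv_two_pow.comp (Computable.fst.nat_add (Computable.const 2))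
    exact Computable.cond ((hu.comp hk).decide_rat_lt hε)
      (((hb.comp hk).rat_sub_s11 hε).pair ((hb.comp hk).rat_add_s11 hε)) (Computable.const (0, 0))
  refine hx I hI (fun n => ?_) ?_
  · have hsub : (⋃ k : ℕ, Set.Ioo ((I n k).1 : ℝ) ((I n k).2 : ℝ)) ⊆
        Set.Ioo (x - 2 * ε n) (x + 2 * ε n) := by
      refine Set.iUnion_subset fun k y hy => ?_
      by_cases h : u (N + k) < ε n
      · simp only [I, h, decide_true, cond_true, Set.mem_Ioo] at hy
        push_cast at hy
        have h1 := hN (N + k) (Nat.le_add_right _ _)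
        have h2 : (u (N + k) : ℝ) < ε n := by exact_mod_cast h
        have h3 := hbx (N + k)
        have h4 := hε0 n
        constructor <;> linarith
      · simp [I, h] at hy
    refine (MeasureTheory.measure_mono hsub).trans ?_
    rw [Real.volume_Ioo]
    have h : x + 2 * (ε n : ℝ) - (x - 2 * ε n) = (2 ^ n)⁻¹ := by
      simp only [ε]
      push_cast
      rw [pow_add]
      field_simp
      ring
    rw [h, ENNReal.ofReal_inv_of_pos (by positivity), ENNReal.ofReal_pow (by norm_num),
      ENNReal.ofReal_ofNat, ENNReal.zpow_neg, zpow_natCast]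
  · refine Set.mem_iInter.2 fun n => ?_
    obtain ⟨k, hk, hkN⟩ := ((hulim.eventually_lt_const (hε0 n)).and
      (Filter.eventually_ge_atTop N)).exists
    obtain ⟨j, rfl⟩ := Nat.exists_eq_add_of_le hkN
    refine Set.mem_iUnion.2 ⟨j, ?_⟩
    have h : u (N + j) < ε n := by exact_mod_cast hk
    simp only [I, h, decide_true, cond_true, Set.mem_Ioo]
    push_cast
    have h1 := hN (N + j) hkN
    have h3 := hbx (N + j)
    have h4 := hε0 n
    constructor <;> linarith

lemma LeftCEApprox.le_s11 {q : ℕ → ℚ} {x : ℝ} (h : LeftCEApprox q x) (n : ℕ) : (q n : ℝ) ≤ x :=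
  Monotone.ge_of_tendsto (fun _ _ hmn => by exact_mod_cast h.2.1 hmn) h.2.2 n

lemma LeftCEApprox.lt_s11 {q : ℕ → ℚ} {x : ℝ} (h : LeftCEApprox q x) (hx : MLRandom x) (n : ℕ) :
    (q n : ℝ) < x := by
  refine (h.le_s11 n).lt_of_ne fun hn => ?_
  refine not_mlRandom_of_sub_le h.1 (Computable.const 0) h.le_s11 (by simp)
    (Filter.eventually_atTop.2 ⟨n, fun m hm => ?_⟩) hx
  have : (q n : ℝ) ≤ q m := by exact_mod_cast h.2.1 hm
  simp only [Rat.cast_zero]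
  linarith

section

variable {α β : ℝ} {a b : ℕ → ℚ} {L : ℝ}

lemma leftCE_of_limit_ratio_lt (hβr : MLRandom β) (ha : LeftCEApprox a α) (hb : LeftCEApprox b β)
    (hL : Filter.Tendsto (fun s => (α - (a s : ℝ)) / (β - (b s : ℝ))) Filter.atTop (nhds L))
    {q : ℚ} (hq : L < q) : LeftCE ((q : ℝ) * β - α) := by
  refine LeftCE.of_eventually_le (((Computable.const q).rat_mul_s11 hb.1).rat_sub_s11 ha.1) ?_ ?_
  · push_cast
    exact (hb.2.2.const_mul _).sub ha.2.2
  · filter_upwards [hL.eventually_lt_const hq] with s hs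
    rw [div_lt_iff₀ (sub_pos.2 (hb.lt_s11 hβr s))] at hs
    push_cast
    linarith

lemma rightCE_of_lt_limit_ratio (hβr : MLRandom β) (ha : LeftCEApprox a α) (hb : LeftCEApprox b β)
    (hL : Filter.Tendsto (fun s => (α - (a s : ℝ)) / (β - (b s : ℝ))) Filter.atTop (nhds L))
    {p : ℚ} (hp : p < L) : RightCE ((p : ℝ) * β - α) := by
  refine LeftCE.of_eventually_le (ha.1.rat_sub_s11 ((Computable.const p).rat_mul_s11 hb.1)) ?_ ?_
  · push_cast
    rw [neg_sub]
    exact ha.2.2.sub (hb.2.2.const_mul _)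
  · filter_upwards [hL.eventually_const_lt hp] with s hs
    rw [lt_div_iff₀ (sub_pos.2 (hb.lt_s11 hβr s))] at hs
    push_cast
    linarith

lemma limit_ratio_le_of_leftCE (hβr : MLRandom β) (ha : LeftCEApprox a α) (hb : LeftCEApprox b β)
    (hL : Filter.Tendsto (fun s => (α - (a s : ℝ)) / (β - (b s : ℝ))) Filter.atTop (nhds L))
    {q : ℚ} (hq : LeftCE ((q : ℝ) * β - α)) : L ≤ q := by
  by_contra! hlt
  obtain ⟨d, hd⟩ := hq
  obtain ⟨r, hqr, hrL⟩ := exists_rat_btwn hlt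
  have hε : (0 : ℝ) < r - q := sub_pos.2 hqr
  refine not_mlRandom_of_sub_le hb.1 ((Computable.const (1 / (r - q))).rat_mul_s11
    ((((Computable.const q).rat_mul_s11 hb.1).rat_sub_s11 ha.1).rat_sub_s11 hd.1)) hb.le_s11 ?_ ?_ hβr
  · push_cast
    simpa using ((((hb.2.2.const_mul (q : ℝ)).sub ha.2.2).sub hd.2.2).const_mul
      (1 / ((r : ℝ) - q)))
  · filter_upwards [hL.eventually_const_lt hrL] with s hs
    rw [lt_div_iff₀ (sub_pos.2 (hb.lt_s11 hβr s))] at hs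
    have := hd.le_s11 s
    push_cast
    rw [one_div_mul_eq_div, le_div_iff₀ hε]
    linarith

lemma le_limit_ratio_of_rightCE (hβr : MLRandom β) (ha : LeftCEApprox a α) (hb : LeftCEApprox b β)
    (hL : Filter.Tendsto (fun s => (α - (a s : ℝ)) / (β - (b s : ℝ))) Filter.atTop (nhds L))
    {p : ℚ} (hp : RightCE ((p : ℝ) * β - α)) : p ≤ L := by
  by_contra! hlt
  obtain ⟨d, hd⟩ := hp
  obtain ⟨r, hLr, hrp⟩ := exists_rat_btwn hlt
  have hε : (0 : ℝ) < p - r := sub_pos.2 hrp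
  refine not_mlRandom_of_sub_le hb.1 ((Computable.const (1 / (p - r))).rat_mul_s11
    ((ha.1.rat_sub_s11 ((Computable.const p).rat_mul_s11 hb.1)).rat_sub_s11 hd.1)) hb.le_s11 ?_ ?_ hβr
  · push_cast
    simpa using (((ha.2.2.sub (hb.2.2.const_mul (p : ℝ))).sub hd.2.2).const_mul
      (1 / ((p : ℝ) - r)))
  · filter_upwards [hL.eventually_lt_const hLr] with s hs
    rw [div_lt_iff₀ (sub_pos.2 (hb.lt_s11 hβr s))] at hs
    have := hd.le_s11 s
    push_cast
    rw [one_div_mul_eq_div, le_div_iff₀ hε]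
    linarith

end

/-- D(α,β) is the infimum of the rationals q with qβ − α left-c.e.,
and the supremum of the rationals p with pβ − α right-c.e. -/
theorem stmt_11 (α β : ℝ) (hαl : LeftCE α) (hβl : LeftCE β)
    (hαr : MLRandom α) (hβr : MLRandom β)
    (a b : ℕ → ℚ) (ha : LeftCEApprox a α) (hb : LeftCEApprox b β) (L : ℝ)
    (hL : Filter.Tendsto (fun s => (α - (a s : ℝ)) / (β - (b s : ℝ)))
      Filter.atTop (nhds L)) :
    L = sInf {x : ℝ | ∃ q : ℚ, x = (q : ℝ) ∧ LeftCE ((q : ℝ) * β - α)} ∧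
    L = sSup {x : ℝ | ∃ p : ℚ, x = (p : ℝ) ∧ RightCE ((p : ℝ) * β - α)} := by
  constructor
  · obtain ⟨q₀, hq₀⟩ := exists_rat_gt L
    refine (csInf_eq_of_forall_ge_of_forall_gt_exists_lt ?_ ?_ fun w hw => ?_).symm
    · exact ⟨(q₀ : ℝ), q₀, rfl, leftCE_of_limit_ratio_lt hβr ha hb hL hq₀⟩
    · rintro _ ⟨q, rfl, hq⟩
      exact limit_ratio_le_of_leftCE hβr ha hb hL hq
    · obtain ⟨q, hLq, hqw⟩ := exists_rat_btwn hw
      exact ⟨q, ⟨q, rfl, leftCE_of_limit_ratio_lt hβr ha hb hL hLq⟩, hqw⟩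
  · obtain ⟨p₀, hp₀⟩ := exists_rat_lt L
    refine (csSup_eq_of_forall_le_of_forall_lt_exists_gt ?_ ?_ fun w hw => ?_).symm
    · exact ⟨(p₀ : ℝ), p₀, rfl, rightCE_of_lt_limit_ratio hβr ha hb hL hp₀⟩
    · rintro _ ⟨p, rfl, hp⟩
      exact le_limit_ratio_of_rightCE hβr ha hb hL hp
    · obtain ⟨p, hwp, hpL⟩ := exists_rat_btwn hw
      exact ⟨p, ⟨p, rfl, rightCE_of_lt_limit_ratio hβr ha hb hL hpL⟩, hwp⟩
end

section
/- Let U be a universal prefix-free machine, let s ∈ (0,1] be rational, and set Ω^s = Σ_{σ ∈ dom(U)} 2^{−|σ|/s} (this series converges since 2^{−|σ|/s} ≤ 2^{−|σ|}). Then for every optimal prefix-free machine determining K there is a constant c such that K(Ω^s↾n) ≥ s·n − c for all n. -/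
open scoped Classical

/-- Tadaki's generalized halting probability Ω^s = Σ_{σ ∈ dom U} 2^{−|σ|/s}. -/
noncomputable def omegaS (U : PFMachine) (s : ℚ) : ℝ :=
  ∑' σ : {σ : List Bool // (U.f σ).Dom}, (2 : ℝ) ^ (-((σ.1.length : ℝ) / (s : ℝ)))

theorem exists_primrec_enumeration {α β : Type*} [Primcodable α] [Primcodable β]
    {f : α →. β} (hf : Partrec f) :
    ∃ E : ℕ → List (α × β), Primrec E ∧ (∀ t, ∀ x ∈ E t, x.2 ∈ f x.1) ∧
      (∀ a, ∀ b ∈ f a, ∀ᶠ t in Filter.atTop, (a, b) ∈ E t) ∧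
      ∀ t, ((E t).map Prod.fst).Nodup := by
  obtain ⟨c, hc⟩ := Nat.Partrec.Code.exists_code.1 hf
  have eval_encode : ∀ a, c.eval (Encodable.encode a) = (f a).map Encodable.encode := by
    intro a; rw [hc]; simp
  let step : ℕ → ℕ → Option (α × β) := fun t n =>
    (Encodable.decode₂ α n).bind fun a =>
      (Nat.Partrec.Code.evaln t c n).bind fun m =>
        (Encodable.decode m : Option β).map fun b => (a, b)
  have mem_step : ∀ t n a b, (a, b) ∈ step t n ↔
      Encodable.encode a = n ∧ ∃ m ∈ Nat.Partrec.Code.evaln t c n,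
        Encodable.decode m = some b := by
    intro t n a b
    simp only [step, Option.mem_def, Option.bind_eq_some_iff, Option.map_eq_some_iff,
      Encodable.decode₂_eq_some, Prod.mk.injEq]
    constructor
    · rintro ⟨a', h1, m, h2, b', h3, rfl, rfl⟩
      exact ⟨h1, m, h2, h3⟩
    · rintro ⟨h1, m, h2, h3⟩
      exact ⟨a, h1, m, h2, b, h3, rfl, rfl⟩
  have step_primrec : Primrec₂ step := by
    have hdec : Primrec fun p : ℕ × ℕ => Encodable.decode₂ α p.2 :=
      Primrec.decode₂.comp Primrec.snd
    have heval : Primrec fun q : (ℕ × ℕ) × α => Nat.Partrec.Code.evaln q.1.1 c q.1.2 :=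
      Nat.Partrec.Code.primrec_evaln.comp
        (Primrec.pair (Primrec.pair (Primrec.fst.comp Primrec.fst) (Primrec.const c))
          (Primrec.snd.comp Primrec.fst))
    refine Primrec.option_bind hdec (Primrec.option_bind heval (Primrec₂.mk ?_))
    exact Primrec.option_map (Primrec.decode.comp Primrec.snd)
      (Primrec.pair ((Primrec.snd.comp Primrec.fst).comp Primrec.fst) Primrec.snd).to₂
  refine ⟨fun t => (List.range t).filterMap (step t),
    Primrec.listFilterMap Primrec.list_range step_primrec, ?_, ?_, ?_⟩
  · rintro t ⟨a, b⟩ hx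
    obtain ⟨n, -, hn⟩ := List.mem_filterMap.1 hx
    obtain ⟨rfl, m, hm, hb⟩ := (mem_step t n a b).1 hn
    have := Nat.Partrec.Code.evaln_sound hm
    rw [eval_encode] at this
    obtain ⟨b', hb', rfl⟩ := (Part.mem_map_iff _).1 this
    rw [Encodable.encodek, Option.some.injEq] at hb
    exact hb ▸ hb'
  · intro a b hb
    have : Encodable.encode b ∈ c.eval (Encodable.encode a) := by
      rw [eval_encode]; exact Part.mem_map _ hb
    obtain ⟨k, hk⟩ := Nat.Partrec.Code.evaln_complete.1 this
    filter_upwards [Filter.eventually_ge_atTop k] with t ht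
    have hk' := Nat.Partrec.Code.evaln_mono ht hk
    exact List.mem_filterMap.2 ⟨Encodable.encode a,
      List.mem_range.2 (Nat.Partrec.Code.evaln_bound hk'),
      (mem_step t _ a b).2 ⟨rfl, _, hk', Encodable.encodek b⟩⟩
  · intro t
    rw [List.map_filterMap]
    refine List.Nodup.filterMap ?_ List.nodup_range
    intro n n' a h h'
    simp only [Option.mem_def, Option.map_eq_some_iff, Prod.exists] at h h'
    obtain ⟨a₁, b₁, h₁, rfl⟩ := h
    obtain ⟨a₂, b₂, h₂, rfl⟩ := h'
    exact ((mem_step t n _ _).1 h₁).1.symm.trans ((mem_step t n' _ _).1 h₂).1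

theorem primrec_nat_pow : Primrec₂ ((· ^ ·) : ℕ → ℕ → ℕ) :=
  Primrec₂.unpaired'.1 Nat.Primrec.pow

theorem primrec_list_sum : Primrec (List.sum : List ℕ → ℕ) :=
  (Primrec.list_foldr Primrec.id (Primrec.const 0)
    (Primrec.nat_add.comp (Primrec.fst.comp Primrec.snd)
      (Primrec.snd.comp Primrec.snd)).to₂).of_eq fun l => by
    simp [List.sum_eq_foldr]

theorem primrec_floor_two_pow_mul_rpow {s : ℚ} (hs : 0 < s) :
    Primrec₂ fun t l : ℕ => ⌊(2 : ℝ) ^ t * 2 ^ (-((l : ℝ) / (s : ℝ)))⌋₊ := by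
  obtain ⟨a, ha⟩ : ∃ a : ℕ, (a : ℤ) = s.num := ⟨_, Int.toNat_of_nonneg (Rat.num_pos.2 hs).le⟩
  have ha0 : a ≠ 0 := by have := Rat.num_pos.2 hs; omega
  have hsab : (s : ℝ) = (a : ℝ) / (s.den : ℝ) := by
    rw [Rat.cast_def, ← ha]; simp
  have hprim : PrimrecRel fun (x : ℕ × ℕ) (r : ℕ) =>
      r ^ a * 2 ^ (x.2 * s.den) ≤ 2 ^ (x.1 * a) := by
    refine Primrec.nat_le.comp (Primrec.nat_mul.comp ?_ ?_) ?_
    · exact primrec_nat_pow.comp Primrec.snd (Primrec.const a)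
    · exact primrec_nat_pow.comp (Primrec.const 2)
        (Primrec.nat_mul.comp (Primrec.snd.comp Primrec.fst) (Primrec.const _))
    · exact primrec_nat_pow.comp (Primrec.const 2)
        (Primrec.nat_mul.comp (Primrec.fst.comp Primrec.fst) (Primrec.const _))
  refine (Primrec.nat_findGreatest
    (primrec_nat_pow.comp (Primrec.const 2) Primrec.fst) hprim).of_eq ?_
  rintro ⟨t, l⟩
  set y : ℝ := (2 : ℝ) ^ t * 2 ^ (-((l : ℝ) / (s : ℝ))) with hy
  have hy0 : 0 ≤ y := by positivity
  have hypow : y ^ a * 2 ^ (l * s.den) = 2 ^ (t * a) := by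
    have h1 : ((2 : ℝ) ^ (-((l : ℝ) / (s : ℝ)))) ^ a = ((2 : ℝ) ^ (l * s.den))⁻¹ := by
      rw [← Real.rpow_natCast, ← Real.rpow_mul (by norm_num), ← Real.rpow_natCast,
        ← Real.rpow_neg (by norm_num)]
      congr 1
      rw [hsab]
      have : (a : ℝ) ≠ 0 := by exact_mod_cast ha0
      have : (s.den : ℝ) ≠ 0 := by exact_mod_cast s.den_nz
      push_cast
      field_simp
    rw [hy, mul_pow, h1, ← pow_mul, inv_mul_cancel_right₀ (by positivity)]
  have hle : ∀ r : ℕ, r ^ a * 2 ^ (l * s.den) ≤ 2 ^ (t * a) ↔ r ≤ ⌊y⌋₊ := by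
    intro r
    rw [Nat.le_floor_iff hy0, ← pow_le_pow_iff_left₀ (Nat.cast_nonneg r) hy0 ha0,
      ← mul_le_mul_iff_left₀ (show (0 : ℝ) < 2 ^ (l * s.den) by positivity), hypow]
    exact_mod_cast Iff.rfl
  have hbound : ⌊y⌋₊ ≤ 2 ^ t := by
    refine Nat.floor_le_of_le ?_
    push_cast
    refine mul_le_of_le_one_right (by positivity) ?_
    refine Real.rpow_le_one_of_one_le_of_nonpos (by norm_num) ?_
    have : (0 : ℝ) < s := by exact_mod_cast hs
    exact neg_nonpos.2 (by positivity)
  rw [Nat.findGreatest_eq_iff]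
  refine ⟨hbound, fun _ => (hle _).2 le_rfl, fun n hn _ h => ?_⟩
  exact absurd ((hle n).1 h) (not_le.2 hn)

theorem foldl_bits (x : ℝ) (hx : 0 ≤ x) (n : ℕ) :
    (bits x n).foldl (fun N b => 2 * N + b.toNat) ⌊x⌋₊ = ⌊x * 2 ^ n⌋₊ := by
  induction n with
  | zero => simp [bits]
  | succ n ih =>
    have hb : bits x (n + 1) = bits x n ++ [rdigit x n] := by simp [bits, List.range_succ]
    have hhalf : ⌊x * 2 ^ n⌋₊ = ⌊x * 2 ^ (n + 1)⌋₊ / 2 := by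
      rw [← Nat.floor_div_ofNat]
      congr 1
      rw [pow_succ, ← mul_assoc]; simp
    have hcast : ⌊x * 2 ^ (n + 1)⌋ = ((⌊x * 2 ^ (n + 1)⌋₊ : ℕ) : ℤ) :=
      (Int.natCast_floor_eq_floor (by positivity)).symm
    rw [hb, List.foldl_append, ih, hhalf]
    simp only [List.foldl_cons, List.foldl_nil, rdigit, hcast]
    generalize ⌊x * 2 ^ (n + 1)⌋₊ = N
    rcases Nat.mod_two_eq_zero_or_one N with h | h
    · have : ¬ ((N : ℤ) % 2 = 1) := by omega
      simp only [this, decide_false, Bool.toNat_false]; omega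
    · have : (N : ℤ) % 2 = 1 := by omega
      simp only [this, decide_true, Bool.toNat_true]; omega

theorem PrefixFreeSet.uniquelyDecodable {D : Set (List Bool)} (hD : PrefixFreeSet D)
    (hnil : [] ∉ D) : InformationTheory.UniquelyDecodable D := by
  intro L₁
  induction L₁ with
  | nil =>
    intro L₂ _ h₂ h
    cases L₂ with
    | nil => rfl
    | cons w L =>
      have : w = [] := by simp_all
      exact absurd (this ▸ h₂ w (by simp)) hnil
  | cons v L₁ ih =>
    intro L₂ h₁ h₂ h
    cases L₂ with
    | nil =>
      have : v = [] := by simp_all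
      exact absurd (this ▸ h₁ v (by simp)) hnil
    | cons w L₂ =>
      have hv := h₁ v (by simp)
      have hw := h₂ w (by simp)
      simp only [List.flatten_cons] at h
      have hvw : v = w := by
        rcases List.prefix_or_prefix_of_prefix (List.prefix_append v L₁.flatten)
          (h ▸ List.prefix_append w L₂.flatten) with hp | hp
        · exact hD v hv w hw hp
        · exact (hD w hw v hv hp).symm
      subst hvw
      rw [ih L₂ (fun u hu => h₁ u (by simp [hu])) (fun u hu => h₂ u (by simp [hu]))
        (List.append_cancel_left h)]

theorem PrefixFreeSet.summable {D : Set (List Bool)} (hD : PrefixFreeSet D) :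
    Summable fun σ : D => (1 / 2 : ℝ) ^ σ.1.length := by
  by_cases hnil : [] ∈ D
  · have : Subsingleton D := ⟨fun σ τ => Subtype.ext <|
      (hD _ hnil _ σ.2 List.nil_prefix).symm.trans (hD _ hnil _ τ.2 List.nil_prefix)⟩
    exact Summable.of_finite
  · refine summable_of_sum_le (c := 1) (fun _ => by positivity) fun u => ?_
    have hsub : ((u.map (Function.Embedding.subtype (· ∈ D)) : Finset (List Bool)) :
        Set (List Bool)) ⊆ D := by
      intro σ hσ
      simp only [Finset.coe_map, Set.mem_image, Function.Embedding.subtype_apply] at hσ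
      obtain ⟨τ, -, rfl⟩ := hσ
      exact τ.2
    have := InformationTheory.kraft_mcmillan_inequality
      (S := u.map (Function.Embedding.subtype (· ∈ D)))
      (PrefixFreeSet.uniquelyDecodable (fun σ hσ τ hτ => hD σ (hsub hσ) τ (hsub hτ))
        fun h => hnil (hsub h))
    simpa [Finset.sum_map] using this

theorem summable_omegaS (U : PFMachine) {s : ℚ} (hs : 0 < s) (hs1 : s ≤ 1) :
    Summable fun σ : {σ : List Bool // (U.f σ).Dom} =>
      (2 : ℝ) ^ (-((σ.1.length : ℝ) / (s : ℝ))) := by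
  refine Summable.of_nonneg_of_le (fun _ => by positivity) (fun σ => ?_)
    (PrefixFreeSet.summable U.prefixFree)
  have hs0 : (0 : ℝ) < s := by exact_mod_cast hs
  have hs1' : (s : ℝ) ≤ 1 := by exact_mod_cast hs1
  rw [one_div, inv_pow, ← Real.rpow_natCast, ← Real.rpow_neg (by norm_num)]
  refine Real.rpow_le_rpow_of_exponent_le (by norm_num) (neg_le_neg ?_)
  rw [le_div_iff₀ hs0]
  exact mul_le_of_le_one_right (Nat.cast_nonneg _) hs1'

theorem sum_floor_le {α : Type*} (w : α → ℝ) (hw : ∀ a, 0 ≤ w a) (t : ℕ) (l : List α) :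
    (((l.map fun a => ⌊(2 : ℝ) ^ t * w a⌋₊).sum : ℕ) : ℝ) ≤ 2 ^ t * (l.map w).sum := by
  induction l with
  | nil => simp
  | cons a l ih =>
    simp only [List.map_cons, List.sum_cons, Nat.cast_add, mul_add]
    exact add_le_add (Nat.floor_le (mul_nonneg (by positivity) (hw a))) ih

theorem sum_floor_add_le_tsum {α : Type*} {D : Set α} {w : α → ℝ} (hw : ∀ a, 0 ≤ w a)
    (hsum : Summable fun a : D => w a) {l : List α} (hl : l.Nodup) (hlD : ∀ a ∈ l, a ∈ D)
    {b : α} (hbD : b ∈ D) (hb : b ∉ l) (t : ℕ) :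
    (((l.map fun a => ⌊(2 : ℝ) ^ t * w a⌋₊).sum : ℕ) : ℝ) + 2 ^ t * w b ≤
      2 ^ t * ∑' a : D, w a := by
  have h : ((b :: l).map w).sum ≤ ∑' a : D, w a := by
    have hnd : (b :: l).Nodup := List.nodup_cons.2 ⟨hb, hl⟩
    rw [← List.sum_toFinset w hnd,
      ← Finset.sum_subtype_of_mem (p := (· ∈ D)) w (by simpa using ⟨hbD, hlD⟩)]
    exact hsum.sum_le_tsum _ fun _ _ => hw _
  calc _ ≤ 2 ^ t * (l.map w).sum + 2 ^ t * w b := by gcongr; exact sum_floor_le w hw t l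
    _ = 2 ^ t * ((b :: l).map w).sum := by simp; ring
    _ ≤ _ := by gcongr

theorem exists_lt_sum_floor {α : Type*} {D : Set α} {w : α → ℝ}
    (hsum : Summable fun a : D => w a) {l : ℕ → List α} (hl : ∀ t, (l t).Nodup)
    (hlD : ∀ a ∈ D, ∀ᶠ t in Filter.atTop, a ∈ l t) {y : ℝ} (hy : y < ∑' a : D, w a) :
    ∃ t, 2 ^ t * y < ((((l t).map fun a => ⌊(2 : ℝ) ^ t * w a⌋₊).sum : ℕ) : ℝ) := by
  obtain ⟨u, hu⟩ := (hsum.hasSum.eventually_const_lt hy).exists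
  have h1 : ∀ᶠ t : ℕ in Filter.atTop, ∀ a ∈ u, (a : α) ∈ l t :=
    (Filter.eventually_all_finset u).2 fun a _ => hlD a a.2
  have h2 : ∀ᶠ t : ℕ in Filter.atTop,
      (u.card : ℝ) / (∑ a ∈ u, w a - y) < (2 : ℝ) ^ t :=
    (tendsto_pow_atTop_atTop_of_one_lt (by norm_num)).eventually_gt_atTop _
  obtain ⟨t, h1, h2⟩ := (h1.and h2).exists
  refine ⟨t, ?_⟩
  rw [div_lt_iff₀ (sub_pos.2 hu)] at h2
  rw [← List.sum_toFinset _ (hl t)]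
  calc (2 : ℝ) ^ t * y < ∑ a ∈ u, (2 ^ t * w a - 1) := by
        rw [Finset.sum_sub_distrib, ← Finset.mul_sum]; simp; linarith
    _ ≤ ∑ a ∈ u, (⌊(2 : ℝ) ^ t * w a⌋₊ : ℝ) :=
        Finset.sum_le_sum fun a _ => (Nat.sub_one_lt_floor _).le
    _ = ∑ a ∈ u.map (Function.Embedding.subtype (· ∈ D)), (⌊(2 : ℝ) ^ t * w a⌋₊ : ℝ) := by
        simp [Finset.sum_map]
    _ ≤ ∑ a ∈ (l t).toFinset, (⌊(2 : ℝ) ^ t * w a⌋₊ : ℝ) := by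
        refine Finset.sum_le_sum_of_subset_of_nonneg ?_ fun _ _ _ => by positivity
        intro a ha
        obtain ⟨b, hb, rfl⟩ := Finset.mem_map.1 ha
        exact List.mem_toFinset.2 (h1 b hb)
    _ = _ := by push_cast; rfl

/-- A prefix-free machine which turns a program for `σ` into an output of `g t`, where `t` is
the first stage at which `σ` passes the test `p`. -/
def PFMachine.search (V : PFMachine) (p : List Bool → ℕ → Bool) (g : ℕ → List Bool)
    (hp : Primrec₂ p) (hg : Primrec g) : PFMachine where
  f := fun π => (V.f π).bind fun σ => (Nat.rfind (p σ)).map g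
  partrec := V.partrec.bind
    ((Partrec.rfind hp.to_comp.partrec₂).map (hg.to_comp.comp Computable.snd).to₂ |>.comp
      Computable.snd).to₂
  prefixFree := fun σ hσ τ hτ h => V.prefixFree σ hσ.1 τ hτ.1 h

theorem exists_program_of_Kf_le {M : PFMachine} {σ : List Bool} {m : ℕ} (h : Kf M σ ≤ m) :
    ∃ π, σ ∈ M.f π ∧ π.length ≤ m := by
  unfold Kf at h
  rcases isEmpty_or_nonempty {π : List Bool // σ ∈ M.f π} with hE | hN
  · rw [iInf_of_empty, top_le_iff] at h
    exact absurd h (ENat.natCast_ne_top m)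
  · obtain ⟨π, hπ⟩ := ENat.exists_eq_iInf fun π : {π : List Bool // σ ∈ M.f π} =>
      (π.1.length : ℕ∞)
    exact ⟨π, π.2, by rw [← hπ] at h; exact_mod_cast h⟩

theorem true_cons_flatten_notMem (L : List (List Bool)) : true :: L.flatten ∉ L := by
  intro h
  have := (List.sublist_flatten_of_mem h).length_le
  simp at this

/-- Ω^s is weakly s-random: K(Ω^s↾n) ≥ s·n − c for some constant c.
(The inequality "K(Ω^s↾n) ≥ s·n − c" is expressed by: whenever K(Ω^s↾n) ≤ m for a
natural number m, we have s·n − c ≤ m.) -/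
theorem stmt_13 (U : PFMachine) (hU : UniversalPF U) (s : ℚ) (hs : 0 < s) (hs1 : s ≤ 1)
    (V : PFMachine) (hV : OptimalPF V) :
    ∃ c : ℝ, ∀ n m : ℕ, Kf V (bits (omegaS U s) n) ≤ (m : ℕ∞) →
      (s : ℝ) * (n : ℝ) - c ≤ (m : ℝ) := by
  set x := omegaS U s with hx
  have hs0 : (0 : ℝ) < s := by exact_mod_cast hs
  let w : List Bool → ℝ := fun σ => (2 : ℝ) ^ (-((σ.length : ℝ) / (s : ℝ)))
  have hw : ∀ σ, 0 ≤ w σ := fun σ => by positivity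
  let D : Set (List Bool) := {σ | (U.f σ).Dom}
  have hsum : Summable fun σ : D => w σ := summable_omegaS U hs hs1
  have hxsum : x = ∑' σ : D, w σ := rfl
  have hx0 : 0 ≤ x := tsum_nonneg fun _ => by positivity
  obtain ⟨E, hE, hEmem, hEall, hEnd⟩ := exists_primrec_enumeration U.partrec
  let S : ℕ → ℕ := fun t =>
    (((E t).map Prod.fst).map fun σ => ⌊(2 : ℝ) ^ t * w σ⌋₊).sum
  have hS : Primrec S := by
    refine primrec_list_sum.comp (Primrec.list_map
      (Primrec.list_map hE (Primrec.fst.comp Primrec.snd).to₂) ?_)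
    exact (primrec_floor_two_pow_mul_rpow hs).comp Primrec.fst
      (Primrec.list_length.comp Primrec.snd)
  let p : List Bool → ℕ → Bool := fun τ t =>
    decide (2 ^ t * τ.foldl (fun N b => 2 * N + b.toNat) ⌊x⌋₊ < S t * 2 ^ τ.length + 2 ^ t)
  have hp : Primrec₂ p := by
    have hpow : Primrec fun q : List Bool × ℕ => 2 ^ q.2 :=
      primrec_nat_pow.comp (Primrec.const 2) Primrec.snd
    have hfold : Primrec fun τ : List Bool =>
        τ.foldl (fun N b => 2 * N + b.toNat) ⌊x⌋₊ :=
      Primrec.list_foldl Primrec.id (Primrec.const _)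
        (Primrec.nat_add.comp
          (Primrec.nat_mul.comp (Primrec.const 2) (Primrec.fst.comp Primrec.snd))
          ((Primrec.dom_finite Bool.toNat).comp (Primrec.snd.comp Primrec.snd))).to₂
    refine PrimrecRel.decide (Primrec.nat_lt.comp
      (Primrec.nat_mul.comp hpow (hfold.comp Primrec.fst))
      (Primrec.nat_add.comp (Primrec.nat_mul.comp (hS.comp Primrec.snd)
        (primrec_nat_pow.comp (Primrec.const 2) (Primrec.list_length.comp Primrec.fst))) hpow))
  let g : ℕ → List Bool := fun t => true :: ((E t).map Prod.snd).flatten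
  have hg : Primrec g := Primrec.list_cons.comp (Primrec.const true)
    (Primrec.list_flatten.comp (Primrec.list_map hE (Primrec.snd.comp Primrec.snd).to₂))
  obtain ⟨ρ, hρ⟩ := hU (V.search p g hp hg)
  refine ⟨ρ.length + s, fun n m hK => ?_⟩
  obtain ⟨π, hπ, hπm⟩ := exists_program_of_Kf_le hK
  have hp_iff : ∀ t, p (bits x n) t = true ↔
      (2 : ℝ) ^ t * ((⌊x * 2 ^ n⌋₊ - 1) / 2 ^ n) < S t := by
    intro t
    have hlen : (bits x n).length = n := by simp [bits]
    simp only [p, decide_eq_true_eq, foldl_bits x hx0 n, hlen]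
    rw [← mul_div_assoc, div_lt_iff₀ (by positivity), mul_sub, mul_one, sub_lt_iff_lt_add]
    exact_mod_cast Iff.rfl
  have hlow : ((⌊x * 2 ^ n⌋₊ : ℝ) - 1) / 2 ^ n < x := by
    rw [div_lt_iff₀ (by positivity)]
    have := Nat.floor_le (show 0 ≤ x * 2 ^ n by positivity)
    linarith
  have hupp : x * 2 ^ n < (⌊x * 2 ^ n⌋₊ : ℝ) + 1 := Nat.lt_floor_add_one _
  obtain ⟨t₀, ht₀⟩ := exists_lt_sum_floor (D := D) (w := w) hsum hEnd
    (fun σ hσ => (hEall σ _ (Part.get_mem hσ)).mono fun t ht => List.mem_map_of_mem ht)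
    (hxsum ▸ hlow)
  obtain ⟨t, ht, -⟩ := Nat.rfind_min' ((hp_iff t₀).2 ht₀)
  have hpt : p (bits x n) t = true := (Part.mem_some_iff.1 (Nat.rfind_spec ht)).symm
  have hout : g t ∈ U.f (ρ ++ π) := by
    rw [hρ]
    exact Part.mem_bind hπ (Part.mem_map g ht)
  have hfresh : ρ ++ π ∉ (E t).map Prod.fst := by
    intro h
    obtain ⟨⟨σ, τ⟩, hmem, rfl⟩ := List.mem_map.1 h
    refine true_cons_flatten_notMem ((E t).map Prod.snd) ?_
    have : τ = g t := Part.mem_unique (hEmem t _ hmem) hout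
    exact List.mem_map.2 ⟨_, hmem, this⟩
  have hD : ∀ σ ∈ (E t).map Prod.fst, σ ∈ D := by
    intro σ hσ
    obtain ⟨a, ha, rfl⟩ := List.mem_map.1 hσ
    exact (hEmem t a ha).1
  have hgap := sum_floor_add_le_tsum hw hsum (hEnd t) hD (show ρ ++ π ∈ D from hout.1) hfresh t
  rw [← hxsum] at hgap
  have hwlt : w (ρ ++ π) < 2 ^ (1 - (n : ℝ)) := by
    have h1 := (hp_iff t).1 hpt
    have h2 : (2 : ℝ) ^ t * w (ρ ++ π) <
        2 ^ t * (x - ((⌊x * 2 ^ n⌋₊ : ℝ) - 1) / 2 ^ n) := by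
      rw [mul_sub]; linarith
    have h3 := lt_of_mul_lt_mul_left h2 (by positivity)
    refine h3.trans ?_
    rw [Real.rpow_sub (by norm_num), Real.rpow_one, Real.rpow_natCast, sub_lt_iff_lt_add,
      ← add_div, lt_div_iff₀ (by positivity)]
    linarith
  have hexp := (Real.rpow_lt_rpow_left_iff (by norm_num : (1 : ℝ) < 2)).1 hwlt
  have hlen : (n : ℝ) - 1 < ((ρ ++ π).length : ℝ) / s := by linarith
  rw [lt_div_iff₀ hs0, List.length_append, Nat.cast_add] at hlen
  have : (π.length : ℝ) ≤ m := by exact_mod_cast hπm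
  linarith
end
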